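/- (Lemma 3.3) For all x_1, …, x_k, y_1, …, y_k ∈ ℝ, lim_{n→∞} P( ⋂_{i=1}^k { X_j ≤ u_n(x_i) for all j ∈ A_i with ε_j = 1, and X_j ≤ u_n(y_i) for all j ∈ A_i with ε_j = 0 } ) = E ∫_{−∞}^{+∞} ∏_{i=1}^k exp( −(d_i − c_i)( λ g(x_i, z) + (1 − λ) g(y_i, z) ) ) dΦ(z). -/

import Mathlib

open MeasureTheory ProbabilityTheory Filter Real
open scoped Classical NNReal ENNReal

/-- The normalizing levels `u_n(x) = x/a_n + b_n` with `a_n = (2 ln n)^{1/2}` and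
`b_n = a_n - (ln ln n + ln (4π))/(2 a_n)`. -/
noncomputable def un (n : ℕ) (x : ℝ) : ℝ :=
  x / Real.sqrt (2 * Real.log n) +
    (Real.sqrt (2 * Real.log n) -
      (Real.log (Real.log n) + Real.log (4 * Real.pi)) / (2 * Real.sqrt (2 * Real.log n)))

/-- `g(x,z) = exp(-x - γ + √(2γ) z)`. -/
noncomputable def g (γ x z : ℝ) : ℝ := Real.exp (-x - γ + Real.sqrt (2 * γ) * z)

/-- Stein's identity for a centered real Gaussian law. -/
lemma integral_mul_gaussianReal_eq {v : ℝ≥0} {f f' : ℝ → ℝ} {C C' : ℝ}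
    (hf : ∀ x, HasDerivAt f (f' x) x) (hC : ∀ x, |f x| ≤ C) (hC' : ∀ x, |f' x| ≤ C') :
    ∫ x, x * f x ∂(gaussianReal 0 v) = v * ∫ x, f' x ∂(gaussianReal 0 v) := by
  by_cases hv : v = 0
  · subst hv
    simp
  have hv0 : (0 : ℝ) < v := by positivity
  have hfm : Measurable f := (continuous_iff_continuousAt.2 fun x => (hf x).continuousAt).measurable
  have hf'm : Measurable f' := by
    have : f' = deriv f := funext fun x => (hf x).deriv.symm
    rw [this]
    exact measurable_deriv f
  have hp : ∀ x, HasDerivAt (gaussianPDFReal 0 v) (-(x / v) * gaussianPDFReal 0 v x) x := by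
    intro x
    unfold gaussianPDFReal
    have h1 : HasDerivAt (fun x : ℝ => -(x - 0) ^ 2 / (2 * v)) (-(x / v)) x := by
      have := ((((hasDerivAt_id x).sub_const 0).pow 2).neg).div_const (2 * (v : ℝ))
      refine this.congr_deriv ?_
      simp
      field_simp
    have := (h1.exp).const_mul (√(2 * π * v))⁻¹
    refine this.congr_deriv ?_
    ring
  have hpi : Integrable (gaussianPDFReal 0 v) := integrable_gaussianPDFReal 0 v
  have hxp : Integrable (fun x => -(x / v) * gaussianPDFReal 0 v x) := by
    have := (integrable_mul_exp_neg_mul_sq (b := 1 / (2 * v)) (by positivity)).const_mul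
      (-(1 / v) * (√(2 * π * v))⁻¹)
    refine this.congr (ae_of_all _ fun x => ?_)
    simp only [gaussianPDFReal]
    have : -(x - 0) ^ 2 / (2 * (v : ℝ)) = -(1 / (2 * v)) * x ^ 2 := by ring
    rw [this]
    ring
  have key := integral_mul_deriv_eq_deriv_mul_of_integrable (u := f) (v := gaussianPDFReal 0 v)
    (u' := f') (v' := fun x => -(x / v) * gaussianPDFReal 0 v x)
    (fun x _ => hf x) (fun x _ => hp x)
    (hxp.bdd_mul hfm.aestronglyMeasurable (ae_of_all _ hC))
    (hpi.bdd_mul hf'm.aestronglyMeasurable (ae_of_all _ hC'))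
    (hpi.bdd_mul hfm.aestronglyMeasurable (ae_of_all _ hC))
  rw [integral_gaussianReal_eq_integral_smul hv, integral_gaussianReal_eq_integral_smul hv]
  simp only [smul_eq_mul]
  have e1 : (fun x => gaussianPDFReal 0 v x * (x * f x))
      = fun x => -(v : ℝ) * (f x * (-(x / v) * gaussianPDFReal 0 v x)) := by
    funext x
    field_simp
  rw [e1, integral_const_mul, key]
  simp_rw [mul_comm (f' _)]
  ring

/-- Stein's identity for a random variable `U` and a random vector `V` that are jointly Gaussian
and centered, tested against a product of functions of the coordinates of `V`. -/
lemma integral_mul_prod_eq_of_hasGaussianLaw {Ω ι : Type*} [Fintype ι] [DecidableEq ι]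
    [MeasurableSpace Ω] {Q : Measure Ω} {U : Ω → ℝ} {V : ι → Ω → ℝ}
    (hG : HasGaussianLaw (fun ω => (U ω, fun i => V i ω)) Q)
    (hU : ∫ ω, U ω ∂Q = 0)
    {f f' : ι → ℝ → ℝ} {C : ℝ}
    (hf : ∀ i x, HasDerivAt (f i) (f' i x) x) (hC : ∀ i x, |f i x| ≤ C)
    (hC' : ∀ i x, |f' i x| ≤ C) :
    ∫ ω, U ω * ∏ i, f i (V i ω) ∂Q
      = ∑ j, cov[U, V j; Q] * ∫ ω, (∏ i ∈ Finset.univ.erase j, f i (V i ω)) * f' j (V j ω) ∂Q := by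
  have hQ : IsProbabilityMeasure Q := hG.isProbabilityMeasure
  have hUG : HasGaussianLaw U Q := hG.fst
  have hVG : ∀ i, HasGaussianLaw (V i) Q := fun i => hG.snd.eval i
  have hU2 : MemLp U 2 Q := hUG.memLp_two
  have hV2 : ∀ i, MemLp (V i) 2 Q := fun i => (hVG i).memLp_two
  set v : ℝ≥0 := Var[U; Q].toNNReal with hv
  have hvR : (v : ℝ) = Var[U; Q] := Real.coe_toNNReal _ (variance_nonneg _ _)
  have hlaw : Q.map U = gaussianReal 0 v := by
    rw [hUG.map_eq_gaussianReal, hU]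
  by_cases hv0 : (v : ℝ) = 0
  · have hU0 : U =ᵐ[Q] 0 := by
      have h := (evariance_eq_zero_iff hUG.aemeasurable).1
        (by rw [← ofReal_variance hU2, ← hvR, hv0, ENNReal.ofReal_zero])
      filter_upwards [h] with ω hω
      rw [hω, hU]; rfl
    have hc : ∀ j, cov[U, V j; Q] = 0 := by
      intro j
      rw [covariance_eq_sub hU2 (hV2 j), hU, integral_eq_zero_of_ae]
      · simp
      · filter_upwards [hU0] with ω hω
        simp [hω]
    rw [integral_eq_zero_of_ae]
    · simp [hc]
    · filter_upwards [hU0] with ω hω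
      simp [hω]
  set c : ι → ℝ := fun i => cov[U, V i; Q] / v with hc
  set R : ι → Ω → ℝ := fun i ω => V i ω - c i * U ω with hR
  have hind : IndepFun U (fun ω i => R i ω) Q := by
    have hG' : HasGaussianLaw (fun ω => ((fun _ : Unit => U ω), fun i => R i ω)) Q := by
      let L : (ℝ × (ι → ℝ)) →L[ℝ] ((Unit → ℝ) × (ι → ℝ)) :=
        (ContinuousLinearMap.pi fun _ => ContinuousLinearMap.fst ℝ ℝ (ι → ℝ)).prod
          (ContinuousLinearMap.pi fun i =>
            (ContinuousLinearMap.proj i).comp (ContinuousLinearMap.snd ℝ ℝ (ι → ℝ))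
              - c i • ContinuousLinearMap.fst ℝ ℝ (ι → ℝ))
      exact hG.map_fun L
    have h := hG'.indepFun_of_covariance_eval (X := fun _ : Unit => U) (Y := R) ?_
    · exact h.comp (φ := fun x : Unit → ℝ => x ()) (measurable_pi_apply ()) measurable_id
    · intro _ j
      have : R j = V j - c j • U := rfl
      rw [this, covariance_sub_right hU2 (hV2 j) (hU2.const_smul _), covariance_smul_right,
        covariance_self hUG.aemeasurable, ← hvR, hc]
      field_simp
      ring
  have hUm : AEMeasurable U Q := hUG.aemeasurable
  have hRm : AEMeasurable (fun ω i => R i ω) Q :=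
    aemeasurable_pi_lambda _ fun i => (hVG i).aemeasurable.sub (hUm.const_mul _)
  have hprod := (indepFun_iff_map_prod_eq_prod_map_map hUm hRm).1 hind
  have hfc : ∀ i, Continuous (f i) :=
    fun i => continuous_iff_continuousAt.2 fun x => (hf i x).continuousAt
  have hf'm : ∀ i, Measurable (f' i) := by
    intro i
    have : f' i = deriv (f i) := funext fun x => (hf i x).deriv.symm
    rw [this]
    exact measurable_deriv _
  have hC0 : ∀ (s : Finset ι) (w : ι → ℝ), |∏ i ∈ s, f i (w i)| ≤ ∏ _i ∈ s, C := by
    intro s w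
    rw [Finset.abs_prod]
    exact Finset.prod_le_prod (fun _ _ => abs_nonneg _) fun i _ => hC i _
  have hpR : IsProbabilityMeasure (Q.map fun ω i => R i ω) := Measure.isProbabilityMeasure_map hRm
  -- transfer of an integral over `Q` to the product of the laws of `U` and `R`
  have transfer : ∀ F : ℝ × (ι → ℝ) → ℝ, Measurable F →
      Integrable (fun ω => F (U ω, fun i => V i ω)) Q →
      ∫ ω, F (U ω, fun i => V i ω) ∂Q
        = ∫ r, ∫ u, F (u, fun i => r i + c i * u) ∂(gaussianReal 0 v)
            ∂(Q.map fun ω i => R i ω) := by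
    intro F hF hFi
    set F' : ℝ × (ι → ℝ) → ℝ := fun p => F (p.1, fun i => p.2 i + c i * p.1) with hF'
    have hF'm : Measurable F' := by fun_prop
    have e : (fun ω => F (U ω, fun i => V i ω)) = fun ω => F' (U ω, fun i => R i ω) := by
      funext ω
      simp [hF', hR]
    have hae : AEMeasurable (fun ω => (U ω, fun i => R i ω)) Q := hUm.prodMk hRm
    rw [e, ← integral_map (φ := fun ω => (U ω, fun i => R i ω)) hae
      hF'm.aestronglyMeasurable, hprod, hlaw]
    rw [integral_prod_symm]
    rw [← hlaw, ← hprod]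
    rw [integrable_map_measure hF'm.aestronglyMeasurable hae]
    rw [e] at hFi
    exact hFi
  have hfm : ∀ i, Measurable (f i) := fun i => (hfc i).measurable
  rw [transfer (fun p => p.1 * ∏ i, f i (p.2 i)) (by fun_prop)]
  swap
  · simp only
    refine hUG.integrable.mul_bdd (c := ∏ _i : ι, C) ?_ (ae_of_all _ fun ω => ?_)
    · have : AEMeasurable (fun ω => ∏ i, f i (V i ω)) Q :=
        Finset.aemeasurable_fun_prod _ fun i _ => (hfm i).comp_aemeasurable (hVG i).aemeasurable
      exact this.aestronglyMeasurable
    · exact hC0 _ _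
  have hbd : ∀ (j : ι) (w : ι → ℝ),
      |(∏ i ∈ Finset.univ.erase j, f i (w i)) * f' j (w j)|
        ≤ (∏ _i ∈ Finset.univ.erase j, C) * C := by
    intro j w
    rw [abs_mul]
    exact mul_le_mul (hC0 _ _) (hC' _ _) (abs_nonneg _)
      ((abs_nonneg _).trans (hC0 _ w))
  have hVm : ∀ i, AEMeasurable (V i) Q := fun i => (hVG i).aemeasurable
  have hterm : ∀ j, ∫ ω, (∏ i ∈ Finset.univ.erase j, f i (V i ω)) * f' j (V j ω) ∂Q
      = ∫ r, ∫ u, (∏ i ∈ Finset.univ.erase j, f i (r i + c i * u)) * f' j (r j + c j * u)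
          ∂(gaussianReal 0 v) ∂(Q.map fun ω i => R i ω) := by
    intro j
    refine transfer (fun p => (∏ i ∈ Finset.univ.erase j, f i (p.2 i)) * f' j (p.2 j))
      (by have := hf'm j; fun_prop) ?_
    refine Integrable.of_bound (C := (∏ _i ∈ Finset.univ.erase j, C) * C) ?_
      (ae_of_all _ fun ω => hbd j _)
    have h1 : AEMeasurable (fun ω => ∏ i ∈ Finset.univ.erase j, f i (V i ω)) Q :=
      Finset.aemeasurable_fun_prod _ fun i _ => (hfm i).comp_aemeasurable (hVm i)
    exact (h1.mul ((hf'm j).comp_aemeasurable (hVm j))).aestronglyMeasurable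
  have hmeas2 : ∀ j, Measurable fun p : (ι → ℝ) × ℝ =>
      (∏ i ∈ Finset.univ.erase j, f i (p.1 i + c i * p.2)) * f' j (p.1 j + c j * p.2) := by
    intro j
    have := hf'm j
    fun_prop
  have inner : ∀ r : ι → ℝ, ∫ u, u * ∏ i, f i (r i + c i * u) ∂(gaussianReal 0 v)
      = ∑ j, cov[U, V j; Q] * ∫ u, (∏ i ∈ Finset.univ.erase j, f i (r i + c i * u))
          * f' j (r j + c j * u) ∂(gaussianReal 0 v) := by
    intro r
    have hd : ∀ u, HasDerivAt (fun u => ∏ i, f i (r i + c i * u))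
        (∑ j, (∏ i ∈ Finset.univ.erase j, f i (r i + c i * u)) • (f' j (r j + c j * u) * c j)) u := by
      intro u
      refine HasDerivAt.fun_finsetProd fun i _ => ?_
      have h1 : HasDerivAt (fun u => r i + c i * u) (c i) u := by
        simpa using ((hasDerivAt_id u).const_mul (c i)).const_add (r i)
      exact (hf i _).comp u h1
    rw [integral_mul_gaussianReal_eq hd (C := ∏ _i : ι, C)
      (C' := ∑ j, ((∏ _i ∈ Finset.univ.erase j, C) * C) * |c j|)
      (fun u => hC0 _ _) (fun u => ?_)]
    · rw [integral_finsetSum]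
      · rw [Finset.mul_sum]
        refine Finset.sum_congr rfl fun j _ => ?_
        simp only [smul_eq_mul, ← mul_assoc]
        rw [integral_mul_const]
        have hcj : (v : ℝ) * c j = cov[U, V j; Q] := by simp only [hc]; field_simp
        rw [← hcj]
        ring
      · intro j _
        refine Integrable.of_bound (C := ((∏ _i ∈ Finset.univ.erase j, C) * C) * |c j|)
          ?_ (ae_of_all _ fun u => ?_)
        · have := hf'm j
          exact Measurable.aestronglyMeasurable (by fun_prop)
        · rw [smul_eq_mul, ← mul_assoc, Real.norm_eq_abs, abs_mul]
          exact mul_le_mul_of_nonneg_right (hbd j fun i => r i + c i * u) (abs_nonneg _)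
    · refine (Finset.abs_sum_le_sum_abs _ _).trans (Finset.sum_le_sum fun j _ => ?_)
      rw [smul_eq_mul, ← mul_assoc, abs_mul]
      exact mul_le_mul_of_nonneg_right (hbd j fun i => r i + c i * u) (abs_nonneg _)
  simp only [inner]
  rw [integral_finsetSum]
  · refine Finset.sum_congr rfl fun j _ => ?_
    rw [integral_const_mul, hterm]
  · intro j _
    refine Integrable.const_mul ?_ _
    refine Integrable.of_bound (C := (∏ _i ∈ Finset.univ.erase j, C) * C) ?_
      (ae_of_all _ fun r => ?_)
    · exact ((hmeas2 j).stronglyMeasurable.integral_prod_right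
        (ν := gaussianReal 0 v)).aestronglyMeasurable
    · refine (norm_integral_le_of_norm_le_const (C := (∏ _i ∈ Finset.univ.erase j, C) * C)
        (ae_of_all _ fun u => hbd j _)).trans ?_
      simp

/-- Gaussian interpolation: comparison of the expectations of a product of smooth functions under
two centered Gaussian vectors with the same variances. -/
lemma abs_integral_prod_sub_integral_prod_le {Ω ι : Type*} [Fintype ι] [DecidableEq ι]
    [MeasurableSpace Ω] {Q : Measure Ω} {X Y : ι → Ω → ℝ}
    (hG : HasGaussianLaw (fun ω => (fun i => X i ω, fun i => Y i ω)) Q)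
    (hX0 : ∀ i, ∫ ω, X i ω ∂Q = 0) (hY0 : ∀ i, ∫ ω, Y i ω ∂Q = 0)
    (hvar : ∀ i, cov[X i, X i; Q] = cov[Y i, Y i; Q])
    (hXY : ∀ i j, cov[X i, Y j; Q] = 0)
    {f f' f'' : ι → ℝ → ℝ} {C : ℝ}
    (hf : ∀ i x, HasDerivAt (f i) (f' i x) x) (hf' : ∀ i x, HasDerivAt (f' i) (f'' i x) x)
    (hC : ∀ i x, |f i x| ≤ 1) (hC' : ∀ i x, |f' i x| ≤ C) (hC'' : ∀ i x, |f'' i x| ≤ C)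
    {B : ι → ι → ℝ}
    (hB : ∀ θ ∈ Set.Icc 0 (π / 2), ∀ i j, i ≠ j →
      ∫ ω, |f' i (cos θ * X i ω + sin θ * Y i ω)| * |f' j (cos θ * X j ω + sin θ * Y j ω)| ∂Q
        ≤ B i j) :
    |∫ ω, ∏ i, f i (Y i ω) ∂Q - ∫ ω, ∏ i, f i (X i ω) ∂Q|
      ≤ (∑ i, ∑ j ∈ Finset.univ.erase i, |cov[Y i, Y j; Q] - cov[X i, X j; Q]| * B i j)
        * (π / 2) := by
  have hQ : IsProbabilityMeasure Q := hG.isProbabilityMeasure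
  have hXG : ∀ i, HasGaussianLaw (X i) Q := fun i => hG.fst.eval i
  have hYG : ∀ i, HasGaussianLaw (Y i) Q := fun i => hG.snd.eval i
  have hX2 : ∀ i, MemLp (X i) 2 Q := fun i => (hXG i).memLp_two
  have hY2 : ∀ i, MemLp (Y i) 2 Q := fun i => (hYG i).memLp_two
  have hXm : ∀ i, AEMeasurable (X i) Q := fun i => (hXG i).aemeasurable
  have hYm : ∀ i, AEMeasurable (Y i) Q := fun i => (hYG i).aemeasurable
  have hfm : ∀ i, Measurable (f i) := fun i =>
    (continuous_iff_continuousAt.2 fun x => (hf i x).continuousAt).measurable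
  have hf'm : ∀ i, Measurable (f' i) := fun i =>
    (continuous_iff_continuousAt.2 fun x => (hf' i x).continuousAt).measurable
  have hf''m : ∀ i, Measurable (f'' i) := by
    intro i
    have : f'' i = deriv (f' i) := funext fun x => (hf' i x).deriv.symm
    rw [this]
    exact measurable_deriv _
  set W : ℝ → ι → Ω → ℝ := fun θ i ω => cos θ * X i ω + sin θ * Y i ω with hW
  set D : ℝ → ι → Ω → ℝ := fun θ i ω => -sin θ * X i ω + cos θ * Y i ω with hD
  have hWm : ∀ θ i, AEMeasurable (W θ i) Q := fun θ i =>
    ((hXm i).const_mul _).add ((hYm i).const_mul _)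
  have hDm : ∀ θ i, AEMeasurable (D θ i) Q := fun θ i =>
    ((hXm i).const_mul _).add ((hYm i).const_mul _)
  have hC0 : ∀ (s : Finset ι) (w : ι → ℝ), |∏ i ∈ s, f i (w i)| ≤ 1 := by
    intro s w
    rw [Finset.abs_prod]
    exact Finset.prod_le_one (fun _ _ => abs_nonneg _) fun i _ => hC i _
  have hCnn : ∀ _i : ι, 0 ≤ C := fun i => (abs_nonneg _).trans (hC' i 0)
  -- the derivative of the interpolated integrand
  set T : ℝ → Ω → ℝ := fun θ ω =>
    ∑ i, (∏ j ∈ Finset.univ.erase i, f j (W θ j ω)) * (f' i (W θ i ω) * D θ i ω) with hT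
  have hderiv : ∀ θ, Integrable (T θ) Q ∧
      HasDerivAt (fun θ => ∫ ω, ∏ i, f i (W θ i ω) ∂Q) (∫ ω, T θ ω ∂Q) θ := by
    intro θ
    have hmW : ∀ θ, AEMeasurable (fun ω => ∏ i, f i (W θ i ω)) Q := fun θ =>
      Finset.aemeasurable_fun_prod _ fun i _ => (hfm i).comp_aemeasurable (hWm θ i)
    refine hasDerivAt_integral_of_dominated_loc_of_deriv_le (s := Set.univ)
      (bound := fun ω => ∑ i, C * (|X i ω| + |Y i ω|)) Filter.univ_mem
      (Eventually.of_forall fun θ => (hmW θ).aestronglyMeasurable) ?_ ?_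
      (ae_of_all _ fun ω θ _ => ?_) ?_ (ae_of_all _ fun ω θ _ => ?_)
    · exact Integrable.of_bound (hmW θ).aestronglyMeasurable 1 (ae_of_all _ fun ω => hC0 _ _)
    · refine AEMeasurable.aestronglyMeasurable ?_
      refine Finset.aemeasurable_fun_sum _ fun i _ => ?_
      exact (Finset.aemeasurable_fun_prod _ fun j _ => (hfm j).comp_aemeasurable (hWm θ j)).mul
        (((hf'm i).comp_aemeasurable (hWm θ i)).mul (hDm θ i))
    · refine (norm_sum_le _ _).trans (Finset.sum_le_sum fun i _ => ?_)
      rw [norm_mul, norm_mul]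
      have h1 : |D θ i ω| ≤ |X i ω| + |Y i ω| := by
        refine (abs_add_le _ _).trans (add_le_add ?_ ?_)
        · rw [abs_mul, abs_neg]
          exact mul_le_of_le_one_left (abs_nonneg _) (abs_sin_le_one θ)
        · rw [abs_mul]
          exact mul_le_of_le_one_left (abs_nonneg _) (abs_cos_le_one θ)
      have h2 : ‖f' i (W θ i ω)‖ * ‖D θ i ω‖ ≤ C * (|X i ω| + |Y i ω|) :=
        mul_le_mul (hC' i _) h1 (abs_nonneg _) (hCnn i)
      exact (mul_le_of_le_one_left (by positivity) (hC0 _ _)).trans h2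
    · refine integrable_finsetSum _ fun i _ => ?_
      exact (((hXG i).integrable.abs).add ((hYG i).integrable.abs)).const_mul C
    · have := HasDerivAt.fun_finsetProd (u := Finset.univ) (f := fun i θ => f i (W θ i ω))
        (f' := fun i => f' i (W θ i ω) * D θ i ω) (x := θ) (fun i _ => ?_)
      · simpa only [smul_eq_mul] using this
      · have h1 : HasDerivAt (fun θ => W θ i ω) (D θ i ω) θ :=
          ((hasDerivAt_cos θ).mul_const _).add ((hasDerivAt_sin θ).mul_const _)
        exact (hf i _).comp θ h1
  have hcov : ∀ θ i j, cov[D θ i, W θ j; Q]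
      = cos θ * sin θ * (cov[Y i, Y j; Q] - cov[X i, X j; Q]) := by
    intro θ i j
    have e1 : D θ i = (-sin θ) • X i + cos θ • Y i := rfl
    have e2 : W θ j = cos θ • X j + sin θ • Y j := rfl
    rw [e1, e2, covariance_add_left ((hX2 i).const_smul _) ((hY2 i).const_smul _)
      (((hX2 j).const_smul _).add ((hY2 j).const_smul _)),
      covariance_add_right ((hX2 i).const_smul _) ((hX2 j).const_smul _) ((hY2 j).const_smul _),
      covariance_add_right ((hY2 i).const_smul _) ((hX2 j).const_smul _) ((hY2 j).const_smul _)]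
    simp only [covariance_smul_left, covariance_smul_right]
    rw [hXY, covariance_comm (Y i) (X j), hXY]
    ring
  -- Stein's identity bounds each summand of the derivative
  have hstein : ∀ θ ∈ Set.Icc 0 (π / 2), ∀ i,
      |∫ ω, (∏ j ∈ Finset.univ.erase i, f j (W θ j ω)) * (f' i (W θ i ω) * D θ i ω) ∂Q|
      ≤ ∑ j ∈ Finset.univ.erase i, |cov[Y i, Y j; Q] - cov[X i, X j; Q]| * B i j := by
    intro θ hθ i
    set φ : ι → ℝ → ℝ := Function.update f i (f' i) with hφ
    set φ' : ι → ℝ → ℝ := Function.update f' i (f'' i) with hφ'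
    have hφi : φ i = f' i := Function.update_self _ _ _
    have hφj : ∀ j, j ≠ i → φ j = f j := fun j hj => Function.update_of_ne hj _ _
    have hφ'j : ∀ j, j ≠ i → φ' j = f' j := fun j hj => Function.update_of_ne hj _ _
    have hGθ : HasGaussianLaw (fun ω => (D θ i ω, fun j => W θ j ω)) Q := by
      let LX : ((ι → ℝ) × (ι → ℝ)) →L[ℝ] (ι → ℝ) := ContinuousLinearMap.fst ℝ _ _
      let LY : ((ι → ℝ) × (ι → ℝ)) →L[ℝ] (ι → ℝ) := ContinuousLinearMap.snd ℝ _ _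
      let L : ((ι → ℝ) × (ι → ℝ)) →L[ℝ] (ℝ × (ι → ℝ)) :=
        ((ContinuousLinearMap.proj i).comp (-sin θ • LX + cos θ • LY)).prod
          (cos θ • LX + sin θ • LY)
      exact hG.map_fun L
    have hD0 : ∫ ω, D θ i ω ∂Q = 0 := by
      simp only [hD]
      rw [integral_add ((hXG i).integrable.const_mul _) ((hYG i).integrable.const_mul _),
        integral_const_mul, integral_const_mul, hX0, hY0]
      simp
    have key := integral_mul_prod_eq_of_hasGaussianLaw hGθ hD0 (f := φ) (f' := φ')
      (C := max 1 C) ?_ ?_ ?_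
    · have e : (fun ω => (∏ j ∈ Finset.univ.erase i, f j (W θ j ω)) * (f' i (W θ i ω) * D θ i ω))
          = fun ω => D θ i ω * ∏ j, φ j (W θ j ω) := by
        funext ω
        rw [← Finset.mul_prod_erase Finset.univ _ (Finset.mem_univ i), hφi,
          Finset.prod_congr rfl fun j hj => (congrFun (hφj j (Finset.ne_of_mem_erase hj)) _).symm]
        ring
      rw [e, key, ← Finset.add_sum_erase Finset.univ _ (Finset.mem_univ i), hcov, hvar, sub_self,
        mul_zero, zero_mul, zero_add]
      refine (Finset.abs_sum_le_sum_abs _ _).trans (Finset.sum_le_sum fun j hj => ?_)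
      have hji : j ≠ i := Finset.ne_of_mem_erase hj
      rw [abs_mul, hcov, abs_mul]
      have hcs : |cos θ * sin θ| ≤ 1 := by
        rw [abs_mul]
        exact mul_le_one₀ (abs_cos_le_one θ) (abs_nonneg _) (abs_sin_le_one θ)
      refine mul_le_mul (mul_le_of_le_one_left (abs_nonneg _) hcs) ?_ (abs_nonneg _)
        (abs_nonneg _)
      refine (abs_integral_le_integral_abs).trans (le_trans ?_ (hB θ hθ i j hji.symm))
      refine integral_mono_of_nonneg (ae_of_all _ fun ω => abs_nonneg _) ?_
        (ae_of_all _ fun ω => ?_)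
      · refine Integrable.of_bound (C := C * C) ?_ (ae_of_all _ fun ω => ?_)
        · exact ((((hf'm i).comp_aemeasurable (hWm θ i)).abs).mul
            (((hf'm j).comp_aemeasurable (hWm θ j)).abs)).aestronglyMeasurable
        · rw [norm_mul, Real.norm_eq_abs, Real.norm_eq_abs, abs_abs, abs_abs]
          exact mul_le_mul (hC' i _) (hC' j _) (abs_nonneg _) (hCnn i)
      · simp only
        rw [abs_mul, hφ'j j hji]
        refine mul_le_mul_of_nonneg_right ?_ (abs_nonneg _)
        have hi : i ∈ Finset.univ.erase j := Finset.mem_erase.2 ⟨hji.symm, Finset.mem_univ _⟩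
        rw [← Finset.mul_prod_erase _ _ hi, abs_mul, hφi]
        refine mul_le_of_le_one_right (abs_nonneg _) ?_
        rw [Finset.prod_congr rfl fun l hl => by rw [hφj l (Finset.ne_of_mem_erase hl)]]
        exact hC0 _ fun l => W θ l ω
    · intro j x
      by_cases hj : j = i
      · subst hj
        simpa [hφ, hφ'] using hf' j x
      · rw [hφj j hj, hφ'j j hj]
        exact hf j x
    · intro j x
      by_cases hj : j = i
      · subst hj
        rw [hφi]
        exact (hC' j x).trans (le_max_right _ _)
      · rw [hφj j hj]
        exact (hC j x).trans (le_max_left _ _)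
    · intro j x
      by_cases hj : j = i
      · subst hj
        simpa [hφ'] using Or.inr (hC'' j x)
      · rw [hφ'j j hj]
        exact (hC' j x).trans (le_max_right _ _)
  have hTbound : ∀ θ ∈ Set.Icc 0 (π / 2), ‖∫ ω, T θ ω ∂Q‖
      ≤ ∑ i, ∑ j ∈ Finset.univ.erase i, |cov[Y i, Y j; Q] - cov[X i, X j; Q]| * B i j := by
    intro θ hθ
    simp only [hT]
    rw [integral_finsetSum]
    · exact (norm_sum_le _ _).trans (Finset.sum_le_sum fun i _ => hstein θ hθ i)
    · intro i _
      refine Integrable.bdd_mul (c := 1) ?_ ?_ (ae_of_all _ fun ω => hC0 _ _)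
      · refine Integrable.bdd_mul (c := C) ?_
          ((hf'm i).comp_aemeasurable (hWm θ i)).aestronglyMeasurable
          (ae_of_all _ fun ω => hC' i _)
        exact ((hXG i).integrable.const_mul _).add ((hYG i).integrable.const_mul _)
      · exact (Finset.aemeasurable_fun_prod _ fun j _ =>
          (hfm j).comp_aemeasurable (hWm θ j)).aestronglyMeasurable
  have hpi : (0 : ℝ) ≤ π / 2 := by positivity
  have := (convex_Icc (0 : ℝ) (π / 2)).norm_image_sub_le_of_norm_hasDerivWithin_le
    (fun θ _ => (hderiv θ).2.hasDerivWithinAt) hTbound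
    (Set.left_mem_Icc.2 hpi) (Set.right_mem_Icc.2 hpi)
  simpa [hW, abs_of_pos pi_pos] using this

/-- Bound on the product of the Gaussian densities of `A` and of `B` given `A`. -/
lemma gaussianPDFReal_mul_gaussianPDFReal_le {ρ m u a b : ℝ} {v : ℝ≥0} (hv : (v : ℝ) = 1 - ρ ^ 2)
    (hρ : |ρ| ≤ m) (hm : m < 1) (hu : 0 ≤ u) (ha : u ≤ a) (hb : u ≤ b) :
    gaussianPDFReal 0 1 a * gaussianPDFReal (ρ * a) v b
      ≤ (√(1 - m ^ 2))⁻¹ * rexp (-u ^ 2 / (1 + m)) := by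
  have hρ0 := abs_nonneg ρ
  have hm2 : 0 < 1 - m ^ 2 := by nlinarith
  have hρm : ρ ^ 2 ≤ m ^ 2 := by rw [← sq_abs]; gcongr
  have hv0 : (0 : ℝ) < 1 - ρ ^ 2 := by linarith
  unfold gaussianPDFReal
  rw [hv]
  have h2π : (1 : ℝ) ≤ 2 * π := by linarith [pi_gt_three]
  have h1 : (√(2 * π * ((1 : ℝ≥0) : ℝ)))⁻¹ ≤ 1 := by
    apply inv_le_one_of_one_le₀
    rw [Real.one_le_sqrt]
    simpa using h2π
  have h2 : (√(2 * π * (1 - ρ ^ 2)))⁻¹ ≤ (√(1 - m ^ 2))⁻¹ := by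
    apply inv_anti₀ (Real.sqrt_pos.2 hm2)
    apply Real.sqrt_le_sqrt
    nlinarith
  have h3 : rexp (-(a - 0) ^ 2 / (2 * ((1 : ℝ≥0) : ℝ))) * rexp (-(b - ρ * a) ^ 2 / (2 * (1 - ρ ^ 2)))
      ≤ rexp (-u ^ 2 / (1 + m)) := by
    rw [← Real.exp_add, Real.exp_le_exp]
    have e : -(a - 0) ^ 2 / (2 * ((1 : ℝ≥0) : ℝ)) + -(b - ρ * a) ^ 2 / (2 * (1 - ρ ^ 2))
        = -((a ^ 2 + b ^ 2 - 2 * ρ * a * b) / (2 * (1 - ρ ^ 2))) := by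
      push_cast
      field_simp
      ring
    rw [e, neg_div, neg_le_neg_iff]
    have hab : ρ * (a * b) ≤ |ρ| * (a * b) :=
      mul_le_mul_of_nonneg_right (le_abs_self ρ) (mul_nonneg (hu.trans ha) (hu.trans hb))
    have hquad : 2 * (1 - |ρ|) * u ^ 2 ≤ a ^ 2 + b ^ 2 - 2 * ρ * a * b := by
      have ha2 : u ^ 2 ≤ a ^ 2 := by gcongr
      have hb2 : u ^ 2 ≤ b ^ 2 := by gcongr
      have h1ρ : 0 ≤ 1 - |ρ| := by linarith
      nlinarith [mul_nonneg hρ0 (sq_nonneg (a - b)), mul_le_mul_of_nonneg_left ha2 h1ρ,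
        mul_le_mul_of_nonneg_left hb2 h1ρ]
    calc u ^ 2 / (1 + m) ≤ u ^ 2 / (1 + |ρ|) := by gcongr
      _ = 2 * (1 - |ρ|) * u ^ 2 / (2 * (1 - ρ ^ 2)) := by
        rw [← sq_abs ρ]
        have : 1 - |ρ| ^ 2 ≠ 0 := by rw [sq_abs]; exact hv0.ne'
        field_simp
        ring
      _ ≤ _ := by gcongr
  calc _ = ((√(2 * π * ((1 : ℝ≥0) : ℝ)))⁻¹ * (√(2 * π * (1 - ρ ^ 2)))⁻¹)
      * (rexp (-(a - 0) ^ 2 / (2 * ((1 : ℝ≥0) : ℝ)))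
        * rexp (-(b - ρ * a) ^ 2 / (2 * (1 - ρ ^ 2)))) := by ring
    _ ≤ (1 * (√(1 - m ^ 2))⁻¹) * rexp (-u ^ 2 / (1 + m)) := by gcongr
    _ = _ := by ring

lemma lintegral_mul_le_of_hasGaussianLaw {Ω : Type*} [MeasurableSpace Ω] {Q : Measure Ω}
    {A B : Ω → ℝ} (hG : HasGaussianLaw (fun ω => (A ω, B ω)) Q)
    (hA0 : ∫ ω, A ω ∂Q = 0) (hB0 : ∫ ω, B ω ∂Q = 0)
    (hA1 : cov[A, A; Q] = 1) (hB1 : cov[B, B; Q] = 1) {m u : ℝ}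
    (hm : |cov[A, B; Q]| ≤ m) (hm1 : m < 1) (hu : 0 ≤ u) {p q : ℝ → ℝ≥0∞}
    (hp : Measurable p) (hq : Measurable q) (hpu : ∀ x < u, p x = 0) (hqu : ∀ x < u, q x = 0) :
    ∫⁻ ω, p (A ω) * q (B ω) ∂Q
      ≤ ENNReal.ofReal ((√(1 - m ^ 2))⁻¹ * rexp (-u ^ 2 / (1 + m)))
        * ((∫⁻ x, p x) * ∫⁻ x, q x) := by
  have hQ : IsProbabilityMeasure Q := hG.isProbabilityMeasure
  have hA2 : MemLp A 2 Q := hG.fst.memLp_two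
  have hB2 : MemLp B 2 Q := hG.snd.memLp_two
  have hAm : AEMeasurable A Q := hG.fst.aemeasurable
  have hBm : AEMeasurable B Q := hG.snd.aemeasurable
  set ρ := cov[A, B; Q] with hρ
  have hρ2 : ρ ^ 2 < 1 := by
    rw [← sq_abs]
    nlinarith [abs_nonneg ρ]
  set v : ℝ≥0 := (1 - ρ ^ 2).toNNReal with hv
  have hvR : (v : ℝ) = 1 - ρ ^ 2 := Real.coe_toNNReal _ (by linarith)
  have hv0 : v ≠ 0 := by
    intro h
    rw [h, NNReal.coe_zero] at hvR
    linarith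
  set R : Ω → ℝ := fun ω => B ω - ρ * A ω with hR
  have hR' : R = B - ρ • A := rfl
  have hRA : HasGaussianLaw (fun ω => (A ω, R ω)) Q := by
    let L : (ℝ × ℝ) →L[ℝ] (ℝ × ℝ) := (ContinuousLinearMap.fst ℝ ℝ ℝ).prod
      (ContinuousLinearMap.snd ℝ ℝ ℝ - ρ • ContinuousLinearMap.fst ℝ ℝ ℝ)
    exact hG.map_fun L
  have hRm : AEMeasurable R Q := hRA.snd.aemeasurable
  have hind : IndepFun A R Q := by
    refine hRA.indepFun_of_covariance_eq_zero ?_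
    rw [hR', covariance_sub_right hA2 hB2 (hA2.const_smul _), covariance_smul_right, hA1, ← hρ]
    ring
  have hlawA : Q.map A = gaussianReal 0 1 := by
    rw [hG.fst.map_eq_gaussianReal, hA0, ← covariance_self hAm, hA1]
    simp
  have hlawR : Q.map R = gaussianReal 0 v := by
    have hR0 : ∫ ω, R ω ∂Q = 0 := by
      simp only [hR]
      rw [integral_sub hG.snd.integrable (hG.fst.integrable.const_mul _), integral_const_mul, hA0,
        hB0]
      simp
    have hvar : cov[R, R; Q] = 1 - ρ ^ 2 := by
      rw [hR', covariance_sub_left hB2 (hA2.const_smul _) (hB2.sub (hA2.const_smul _)),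
        covariance_sub_right hB2 hB2 (hA2.const_smul _),
        covariance_sub_right (hA2.const_smul _) hB2 (hA2.const_smul _)]
      simp only [covariance_smul_left, covariance_smul_right]
      rw [covariance_comm B A, ← hρ, hA1, hB1]
      ring
    rw [hRA.snd.map_eq_gaussianReal, hR0, ← covariance_self hRm, hvar]
  have hprod := (indepFun_iff_map_prod_eq_prod_map_map hAm hRm).1 hind
  rw [hlawA, hlawR] at hprod
  have hFm : Measurable fun z : ℝ × ℝ => p z.1 * q (z.2 + ρ * z.1) := by fun_prop
  have e1 : ∫⁻ ω, p (A ω) * q (B ω) ∂Q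
      = ∫⁻ a, p a * ∫⁻ b, q b ∂(gaussianReal (ρ * a) v) ∂(gaussianReal 0 1) := by
    have : ∫⁻ ω, p (A ω) * q (B ω) ∂Q
        = ∫⁻ z, p z.1 * q (z.2 + ρ * z.1) ∂(Q.map fun ω => (A ω, R ω)) := by
      rw [lintegral_map' hFm.aemeasurable (hAm.prodMk hRm)]
      simp [hR]
    rw [this, hprod, lintegral_prod _ hFm.aemeasurable]
    refine lintegral_congr fun a => ?_
    simp only
    rw [lintegral_const_mul _ (by fun_prop)]
    congr 1
    have := gaussianReal_map_add_const (μ := 0) (v := v) (ρ * a)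
    rw [zero_add] at this
    rw [← this, lintegral_map hq (by fun_prop)]
  have e2 : ∀ a, p a * gaussianPDF 0 1 a * ∫⁻ b, q b * gaussianPDF (ρ * a) v b
      ≤ p a * (ENNReal.ofReal ((√(1 - m ^ 2))⁻¹ * rexp (-u ^ 2 / (1 + m))) * ∫⁻ b, q b) := by
    intro a
    by_cases ha : a < u
    · simp [hpu a ha]
    rw [mul_assoc]
    refine mul_le_mul_right ?_ _
    rw [← lintegral_const_mul _ (by fun_prop), ← lintegral_const_mul _ (by fun_prop)]
    refine lintegral_mono fun b => ?_
    by_cases hb : b < u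
    · simp [hqu b hb]
    rw [← mul_assoc, mul_right_comm]
    refine mul_le_mul_left ?_ _
    unfold gaussianPDF
    rw [← ENNReal.ofReal_mul (gaussianPDFReal_nonneg _ _ _)]
    exact ENNReal.ofReal_le_ofReal (gaussianPDFReal_mul_gaussianPDFReal_le hvR hm hm1 hu
      (not_lt.1 ha) (not_lt.1 hb))
  rw [e1, gaussianReal_of_var_ne_zero 0 one_ne_zero]
  have hm' : Measurable fun a => ∫⁻ b, q b ∂(gaussianReal (ρ * a) v) := by
    have : (fun a => ∫⁻ b, q b ∂(gaussianReal (ρ * a) v))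
        = fun a => ∫⁻ b, q (b + ρ * a) ∂(gaussianReal 0 v) := by
      funext a
      have := gaussianReal_map_add_const (μ := 0) (v := v) (ρ * a)
      rw [zero_add] at this
      rw [← this, lintegral_map hq (by fun_prop)]
    rw [this]
    exact Measurable.lintegral_prod_right' (f := fun z : ℝ × ℝ => q (z.2 + ρ * z.1)) (by fun_prop)
  rw [lintegral_withDensity_eq_lintegral_mul _ (measurable_gaussianPDF 0 1) (by fun_prop)]
  calc _ ≤ ∫⁻ a, p a * (ENNReal.ofReal ((√(1 - m ^ 2))⁻¹ * rexp (-u ^ 2 / (1 + m)))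
        * ∫⁻ b, q b) := by
        refine lintegral_mono fun a => le_trans (le_of_eq ?_) (e2 a)
        simp only [Pi.mul_apply]
        rw [gaussianReal_of_var_ne_zero _ hv0, lintegral_withDensity_eq_lintegral_mul _
          (measurable_gaussianPDF _ _) hq]
        simp only [Pi.mul_apply]
        rw [← mul_assoc, mul_comm (gaussianPDF 0 1 a)]
        simp only [mul_comm]
    _ = _ := by
        rw [lintegral_mul_const _ hp]
        ring

/-- A smooth step function from `0` to `1` with bounded first and second derivatives. -/
lemma exists_smooth_step : ∃ (σ σ' σ'' : ℝ → ℝ) (K : ℝ), 0 ≤ K ∧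
    (∀ x, HasDerivAt σ (σ' x) x) ∧ (∀ x, HasDerivAt σ' (σ'' x) x) ∧ (∀ x, |σ x| ≤ 1) ∧
    (∀ x, |σ' x| ≤ K) ∧ (∀ x, |σ'' x| ≤ K) ∧ (∀ x ≤ 0, σ x = 0) ∧ (∀ x, 1 ≤ x → σ x = 1) ∧
    (∀ x < 0, σ' x = 0) ∧ (∀ x, 1 < x → σ' x = 0) := by
  have hc : ContDiff ℝ 2 smoothTransition := smoothTransition.contDiff (n := 2)
  have hc1 : ContDiff ℝ 1 (deriv smoothTransition) := by
    have : ContDiff ℝ (1 + 1) smoothTransition := hc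
    exact (contDiff_succ_iff_deriv.1 this).2.2
  have hneg : ∀ x < 0, deriv smoothTransition x = 0 := by
    intro x hx
    have : smoothTransition =ᶠ[nhds x] fun _ => 0 := by
      filter_upwards [Iio_mem_nhds hx] with y hy
      exact smoothTransition.zero_of_nonpos hy.le
    rw [this.deriv_eq, deriv_const]
  have hpos : ∀ x, 1 < x → deriv smoothTransition x = 0 := by
    intro x hx
    have : smoothTransition =ᶠ[nhds x] fun _ => 1 := by
      filter_upwards [Ioi_mem_nhds hx] with y hy
      exact smoothTransition.one_of_one_le (le_of_lt hy)
    rw [this.deriv_eq, deriv_const]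
  have hs : HasCompactSupport (deriv smoothTransition) := by
    refine HasCompactSupport.of_support_subset_isCompact (isCompact_Icc (a := (0 : ℝ)) (b := 1)) ?_
    intro x hx
    rw [Function.mem_support] at hx
    constructor
    · by_contra! h
      exact hx (hneg x h)
    · by_contra! h
      exact hx (hpos x h)
  obtain ⟨K1, hK1⟩ := hs.exists_bound_of_continuous hc1.continuous
  obtain ⟨K2, hK2⟩ := hs.deriv.exists_bound_of_continuous (hc1.continuous_deriv le_rfl)
  refine ⟨smoothTransition, deriv smoothTransition, deriv (deriv smoothTransition), max K1 K2,
    ((norm_nonneg _).trans (hK1 0)).trans (le_max_left _ _),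
    fun x => (hc.differentiable (by norm_num) x).hasDerivAt,
    fun x => (hc1.differentiable (by norm_num) x).hasDerivAt, fun x => ?_,
    fun x => (hK1 x).trans (le_max_left _ _), fun x => (hK2 x).trans (le_max_right _ _),
    fun x hx => smoothTransition.zero_of_nonpos hx, fun x hx => smoothTransition.one_of_one_le hx,
    hneg, hpos⟩
  rw [abs_of_nonneg (smoothTransition.nonneg x)]
  exact smoothTransition.le_one x

/-- The normal comparison inequality, for vectors with unit variances and nonnegative levels. -/
theorem exists_normal_comparison {δ : ℝ} (hδ0 : 0 ≤ δ) (hδ : δ < 1) : ∃ C : ℝ, 0 ≤ C ∧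
    ∀ {Ω ι : Type} [Fintype ι] [DecidableEq ι] [MeasurableSpace Ω] {Q : Measure Ω}
      {X Y : ι → Ω → ℝ}, HasGaussianLaw (fun ω => (fun i => X i ω, fun i => Y i ω)) Q →
      (∀ i, ∫ ω, X i ω ∂Q = 0) → (∀ i, ∫ ω, Y i ω ∂Q = 0) →
      (∀ i, cov[X i, X i; Q] = 1) → (∀ i, cov[Y i, Y i; Q] = 1) →
      (∀ i j, cov[X i, Y j; Q] = 0) → ∀ {m : ι → ι → ℝ},
      (∀ i j, i ≠ j → |cov[X i, X j; Q]| ≤ m i j) → (∀ i j, i ≠ j → |cov[Y i, Y j; Q]| ≤ m i j) →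
      (∀ i j, i ≠ j → m i j ≤ δ) → ∀ {u : ℝ} {l : ι → ℝ}, 0 ≤ u → (∀ i, u ≤ l i) →
      |Q.real {ω | ∀ i, Y i ω ≤ l i} - Q.real {ω | ∀ i, X i ω ≤ l i}|
        ≤ C * ∑ i, ∑ j ∈ Finset.univ.erase i, |cov[Y i, Y j; Q] - cov[X i, X j; Q]|
          * rexp (-u ^ 2 / (1 + m i j)) := by
  obtain ⟨σ, σ', σ'', K, hK, hσ, hσ', hb, hb', hb'', h0, h1, hn, hp⟩ := exists_smooth_step
  set D : ℝ := (√(1 - δ ^ 2))⁻¹ * (K * K) with hD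
  have hD0 : 0 ≤ D := by positivity
  refine ⟨D * (π / 2), by positivity, ?_⟩
  intro Ω ι _ _ _ Q X Y hG hX0 hY0 hX1 hY1 hXY m hmX hmY hmδ u l hu hul
  have hQ : IsProbabilityMeasure Q := hG.isProbabilityMeasure
  have hXm : ∀ i, AEMeasurable (X i) Q := fun i => (hG.fst.eval i).aemeasurable
  have hYm : ∀ i, AEMeasurable (Y i) Q := fun i => (hG.snd.eval i).aemeasurable
  have hX2 : ∀ i, MemLp (X i) 2 Q := fun i => (hG.fst.eval i).memLp_two
  have hY2 : ∀ i, MemLp (Y i) 2 Q := fun i => (hG.snd.eval i).memLp_two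
  have hσm : Measurable σ :=
    (continuous_iff_continuousAt.2 fun x => (hσ x).continuousAt).measurable
  have hσ'm : Measurable σ' :=
    (continuous_iff_continuousAt.2 fun x => (hσ' x).continuousAt).measurable
  -- smooth approximations, at scale `1 / (n + 1)`, of the indicators of `(-∞, l i]`
  have step : ∀ n : ℕ,
      |∫ ω, ∏ i, σ (1 - (n + 1) * (Y i ω - l i)) ∂Q - ∫ ω, ∏ i, σ (1 - (n + 1) * (X i ω - l i)) ∂Q|
      ≤ D * (π / 2) * ∑ i, ∑ j ∈ Finset.univ.erase i, |cov[Y i, Y j; Q] - cov[X i, X j; Q]|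
          * rexp (-u ^ 2 / (1 + m i j)) := by
    intro n
    set s : ℝ := n + 1 with hs
    have hs1 : 1 ≤ s := by simp [hs]
    have hs0 : 0 < s := by positivity
    have hlin : ∀ i x, HasDerivAt (fun x => 1 - s * (x - l i)) (-s) x := by
      intro i x
      simpa using (((hasDerivAt_id x).sub_const (l i)).const_mul s).const_sub 1
    have key := abs_integral_prod_sub_integral_prod_le hG hX0 hY0 (fun i => by rw [hX1, hY1]) hXY
      (f := fun i x => σ (1 - s * (x - l i))) (f' := fun i x => σ' (1 - s * (x - l i)) * (-s))
      (f'' := fun i x => σ'' (1 - s * (x - l i)) * (-s) * (-s)) (C := K * s * s)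
      (B := fun i j => D * rexp (-u ^ 2 / (1 + m i j)))
      (fun i x => (hσ _).comp x (hlin i x))
      (fun i x => ((hσ' _).comp x (hlin i x)).mul_const _) (fun i x => hb _)
      (fun i x => ?_) (fun i x => ?_) ?_
    · refine key.trans (le_of_eq ?_)
      simp only [Finset.mul_sum, Finset.sum_mul]
      refine Finset.sum_congr rfl fun i _ => Finset.sum_congr rfl fun j _ => ?_
      ring
    · rw [abs_mul, abs_neg, abs_of_pos hs0]
      exact (mul_le_mul_of_nonneg_right (hb' _) hs0.le).trans
        (le_mul_of_one_le_right (by positivity) hs1)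
    · rw [abs_mul, abs_mul, abs_neg, abs_of_pos hs0]
      gcongr
      exact hb'' _
    · intro θ _ i j hij
      set p : ι → ℝ → ℝ≥0∞ := fun i x => ENNReal.ofReal |σ' (1 - s * (x - l i)) * (-s)| with hpdef
      have hpm : ∀ i, Measurable (p i) := fun i => by fun_prop
      have hpu : ∀ i, ∀ x < u, p i x = 0 := by
        intro i x hx
        have : 1 < 1 - s * (x - l i) := by nlinarith [hul i]
        simp [hpdef, hp _ this]
      have hpint : ∀ i, ∫⁻ x, p i x ≤ ENNReal.ofReal K := by
        intro i
        have hsup : ∀ x, p i x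
            ≤ (Set.Icc (l i) (l i + 1 / s)).indicator (fun _ => ENNReal.ofReal (K * s)) x := by
          intro x
          by_cases hx : x ∈ Set.Icc (l i) (l i + 1 / s)
          · rw [Set.indicator_of_mem hx]
            refine ENNReal.ofReal_le_ofReal ?_
            rw [abs_mul, abs_neg, abs_of_pos hs0]
            exact mul_le_mul_of_nonneg_right (hb' _) hs0.le
          · rw [Set.indicator_of_notMem hx]
            rw [Set.mem_Icc, not_and_or, not_le, not_le] at hx
            rcases hx with hx | hx
            · have : 1 < 1 - s * (x - l i) := by nlinarith
              simp [hpdef, hp _ this]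
            · have : 1 - s * (x - l i) < 0 := by
                have := mul_lt_mul_of_pos_left (sub_lt_sub_right hx (l i)) hs0
                rw [add_sub_cancel_left, mul_one_div_cancel hs0.ne'] at this
                linarith
              simp [hpdef, hn _ this]
        refine (lintegral_mono hsup).trans ?_
        rw [lintegral_indicator measurableSet_Icc, setLIntegral_const, Real.volume_Icc,
          ← ENNReal.ofReal_mul (by positivity)]
        refine ENNReal.ofReal_le_ofReal (le_of_eq ?_)
        field_simp
        ring
      have hWG : HasGaussianLaw (fun ω => (cos θ * X i ω + sin θ * Y i ω,
          cos θ * X j ω + sin θ * Y j ω)) Q := by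
        let LX : ((ι → ℝ) × (ι → ℝ)) →L[ℝ] (ι → ℝ) := ContinuousLinearMap.fst ℝ _ _
        let LY : ((ι → ℝ) × (ι → ℝ)) →L[ℝ] (ι → ℝ) := ContinuousLinearMap.snd ℝ _ _
        let L : ((ι → ℝ) × (ι → ℝ)) →L[ℝ] (ℝ × ℝ) :=
          ((ContinuousLinearMap.proj i).comp (cos θ • LX + sin θ • LY)).prod
            ((ContinuousLinearMap.proj j).comp (cos θ • LX + sin θ • LY))
        exact hG.map_fun L
      have hW0 : ∀ i, ∫ ω, (cos θ * X i ω + sin θ * Y i ω) ∂Q = 0 := by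
        intro i
        rw [integral_add ((hG.fst.eval i).integrable.const_mul _)
          ((hG.snd.eval i).integrable.const_mul _), integral_const_mul, integral_const_mul, hX0,
          hY0]
        simp
      have hWcov : ∀ i j, cov[fun ω => cos θ * X i ω + sin θ * Y i ω,
          fun ω => cos θ * X j ω + sin θ * Y j ω; Q]
          = cos θ ^ 2 * cov[X i, X j; Q] + sin θ ^ 2 * cov[Y i, Y j; Q] := by
        intro i j
        have e : ∀ i, (fun ω => cos θ * X i ω + sin θ * Y i ω) = cos θ • X i + sin θ • Y i :=
          fun i => rfl
        rw [e, e, covariance_add_left ((hX2 i).const_smul _) ((hY2 i).const_smul _)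
          (((hX2 j).const_smul _).add ((hY2 j).const_smul _)),
          covariance_add_right ((hX2 i).const_smul _) ((hX2 j).const_smul _)
            ((hY2 j).const_smul _),
          covariance_add_right ((hY2 i).const_smul _) ((hX2 j).const_smul _)
            ((hY2 j).const_smul _)]
        simp only [covariance_smul_left, covariance_smul_right]
        rw [hXY, covariance_comm (Y i) (X j), hXY]
        ring
      have hcs := cos_sq_add_sin_sq θ
      have hmij0 : 0 ≤ m i j := (abs_nonneg _).trans (hmX i j hij)
      have hWm : |cos θ ^ 2 * cov[X i, X j; Q] + sin θ ^ 2 * cov[Y i, Y j; Q]| ≤ m i j := by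
        refine (abs_add_le _ _).trans ?_
        rw [abs_mul, abs_mul, abs_of_nonneg (sq_nonneg (cos θ)), abs_of_nonneg (sq_nonneg (sin θ))]
        nlinarith [mul_le_mul_of_nonneg_left (hmX i j hij) (sq_nonneg (cos θ)),
          mul_le_mul_of_nonneg_left (hmY i j hij) (sq_nonneg (sin θ))]
      have hl := lintegral_mul_le_of_hasGaussianLaw hWG (hW0 i) (hW0 j)
        (by rw [hWcov, hX1, hY1]; linarith) (by rw [hWcov, hX1, hY1]; linarith)
        (by rw [hWcov]; exact hWm) ((hmδ i j hij).trans_lt hδ) hu (hpm i) (hpm j) (hpu i) (hpu j)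
      have hWae : ∀ i, AEMeasurable (fun ω => cos θ * X i ω + sin θ * Y i ω) Q := fun i =>
        ((hXm i).const_mul _).add ((hYm i).const_mul _)
      rw [integral_eq_lintegral_of_nonneg_ae (ae_of_all _ fun ω => by positivity)]
      swap
      · have hpm' : ∀ i, Measurable fun x => |σ' (1 - s * (x - l i)) * (-s)| :=
          fun i => by fun_prop
        exact (((hpm' i).comp_aemeasurable (hWae i)).mul
          ((hpm' j).comp_aemeasurable (hWae j))).aestronglyMeasurable
      refine ENNReal.toReal_le_of_le_ofReal (by positivity) ?_
      simp only [ENNReal.ofReal_mul (abs_nonneg _)]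
      refine hl.trans ((mul_le_mul_right (mul_le_mul' (hpint i) (hpint j)) _).trans ?_)
      rw [← ENNReal.ofReal_mul hK, ← ENNReal.ofReal_mul (by positivity)]
      refine ENNReal.ofReal_le_ofReal ?_
      have : (√(1 - m i j ^ 2))⁻¹ ≤ (√(1 - δ ^ 2))⁻¹ := by
        apply inv_anti₀ (Real.sqrt_pos.2 (by nlinarith))
        apply Real.sqrt_le_sqrt
        have := hmδ i j hij
        gcongr
      rw [hD]
      calc _ = (√(1 - m i j ^ 2))⁻¹ * (rexp (-u ^ 2 / (1 + m i j)) * (K * K)) := by ring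
        _ ≤ (√(1 - δ ^ 2))⁻¹ * (rexp (-u ^ 2 / (1 + m i j)) * (K * K)) := by gcongr
        _ = _ := by ring
  -- pass to the limit
  have hlim : ∀ Z : ι → Ω → ℝ, (∀ i, AEMeasurable (Z i) Q) →
      Tendsto (fun n : ℕ => ∫ ω, ∏ i, σ (1 - (n + 1) * (Z i ω - l i)) ∂Q) atTop
        (nhds (Q.real {ω | ∀ i, Z i ω ≤ l i})) := by
    intro Z hZ
    have hset : NullMeasurableSet {ω | ∀ i, Z i ω ≤ l i} Q := by
      rw [Set.ofPred_forall]
      exact NullMeasurableSet.iInter fun i => nullMeasurableSet_le (hZ i) aemeasurable_const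
    have e : Q.real {ω | ∀ i, Z i ω ≤ l i}
        = ∫ ω, {ω | ∀ i, Z i ω ≤ l i}.indicator (fun _ => (1 : ℝ)) ω ∂Q := by
      rw [integral_indicator₀ hset]
      simp
    rw [e]
    refine tendsto_integral_of_dominated_convergence (fun _ => 1) (fun n => ?_)
      (integrable_const _) (fun n => ae_of_all _ fun ω => ?_) (ae_of_all _ fun ω => ?_)
    · refine AEMeasurable.aestronglyMeasurable (Finset.aemeasurable_fun_prod _ fun i _ => ?_)
      exact hσm.comp_aemeasurable ((((hZ i).sub_const _).const_mul _).const_sub _)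
    · rw [Real.norm_eq_abs, Finset.abs_prod]
      exact Finset.prod_le_one (fun _ _ => abs_nonneg _) fun i _ => hb _
    · by_cases hω : ∀ i, Z i ω ≤ l i
      · rw [Set.indicator_of_mem (show ω ∈ {ω | ∀ i, Z i ω ≤ l i} from hω)]
        refine tendsto_const_nhds.congr fun n => ?_
        refine (Finset.prod_eq_one fun i _ => h1 _ ?_).symm
        have : ((n : ℝ) + 1) * (Z i ω - l i) ≤ 0 :=
          mul_nonpos_of_nonneg_of_nonpos (by positivity) (by linarith [hω i])
        linarith
      · rw [Set.indicator_of_notMem (show ω ∉ {ω | ∀ i, Z i ω ≤ l i} from hω)]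
        push Not at hω
        obtain ⟨i, hi⟩ := hω
        have hpos : 0 < Z i ω - l i := by linarith
        obtain ⟨N, hN⟩ := exists_nat_gt (1 / (Z i ω - l i))
        refine tendsto_const_nhds.congr' ?_
        filter_upwards [eventually_ge_atTop N] with n hn
        refine (Finset.prod_eq_zero (Finset.mem_univ i) (h0 _ ?_)).symm
        have hNn : (N : ℝ) ≤ n := by exact_mod_cast hn
        have : 1 / (Z i ω - l i) < (n : ℝ) + 1 := by linarith
        rw [div_lt_iff₀ hpos] at this
        linarith
  exact le_of_tendsto (((hlim Y hYm).sub (hlim X hXm)).abs) (Eventually.of_forall step)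

lemma tendsto_log_natCast : Tendsto (fun n : ℕ => log (n : ℝ)) atTop atTop :=
  tendsto_log_atTop.comp tendsto_natCast_atTop_atTop

/-- `un n x = a + t / a` with `a = √(2 log n)` and `t = x - (log (log n) + log (4 π)) / 2`. -/
lemma un_eq (n : ℕ) (x : ℝ) : un n x = √(2 * log n)
    + (x - (log (log n) + log (4 * π)) / 2) / √(2 * log n) := by
  unfold un
  ring

lemma eventually_un_bounds (x : ℝ) : ∀ᶠ n : ℕ in atTop, 0 ≤ un n x ∧ (un n x) ^ 2 ≤ 2 * log n ∧
    2 * log n - log (log n) + (2 * x - log (4 * π)) ≤ (un n x) ^ 2 := by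
  have hLL : Tendsto (fun n : ℕ => log (log (n : ℝ))) atTop atTop :=
    tendsto_log_atTop.comp tendsto_log_natCast
  filter_upwards [tendsto_log_natCast.eventually_ge_atTop 1,
    tendsto_log_natCast.eventually_ge_atTop (-x + log (4 * π) / 2),
    hLL.eventually_ge_atTop (2 * x - log (4 * π))] with n hL1 hL2 hL3
  set L := log (n : ℝ)
  set t := x - (log L + log (4 * π)) / 2 with ht
  set a := √(2 * L) with ha
  have ha2 : a ^ 2 = 2 * L := Real.sq_sqrt (by linarith)
  have ha0 : 0 < a := Real.sqrt_pos.2 (by linarith)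
  have hu : un n x = a + t / a := un_eq n x
  have ht0 : t ≤ 0 := by rw [ht]; linarith
  have hlogL : log L ≤ L := (Real.log_le_sub_one_of_pos (by linarith)).trans (by linarith)
  have hta : t / a ≤ 0 := div_nonpos_of_nonpos_of_nonneg ht0 ha0.le
  have hu0 : 0 ≤ un n x := by
    rw [hu]
    have : a + t / a = (a ^ 2 + t) / a := by field_simp
    rw [this, ha2]
    refine div_nonneg ?_ ha0.le
    rw [ht]
    linarith
  refine ⟨hu0, ?_, ?_⟩
  · rw [← ha2]
    have : un n x ≤ a := by rw [hu]; linarith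
    gcongr
  · have : (un n x) ^ 2 = a ^ 2 + 2 * t + (t / a) ^ 2 := by
      rw [hu]
      field_simp
      ring
    rw [this, ha2]
    have := sq_nonneg (t / a)
    linarith

lemma sum_log_sub_log_le (n : ℕ) :
    ∑ k ∈ Finset.Icc 1 n, (log (n : ℝ) - log k) ≤ n := by
  rcases Nat.eq_zero_or_pos n with rfl | hn
  · simp
  have h1 : ∑ k ∈ Finset.Icc 1 n, log (k : ℝ) = log (n.factorial : ℝ) := by
    have hI : Finset.Icc 1 n = Finset.Ico 1 (n + 1) := by
      ext
      simp
    rw [hI, ← Finset.prod_Ico_id_eq_factorial, Nat.cast_prod, Real.log_prod]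
    intro k hk
    have := (Finset.mem_Ico.1 hk).1
    positivity
  rw [Finset.sum_sub_distrib, h1, Finset.sum_const, Nat.card_Icc, nsmul_eq_mul]
  have h2 := Real.pow_div_factorial_le_exp (n : ℝ) (by positivity) n
  have hn0 : (0 : ℝ) < n := by exact_mod_cast hn
  have h3 := Real.log_le_log (by positivity) h2
  rw [Real.log_exp, Real.log_div (by positivity) (by positivity), Real.log_pow] at h3
  simpa using h3

/-- The error term in the normal comparison inequality vanishes in the limit. -/
theorem tendsto_comparison_sum {r : ℕ → ℝ} {γ δ : ℝ} (hγ : 0 ≤ γ) (hδ : δ < 1) (hδ2 : 1 / 2 ≤ δ)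
    (hrδ : ∀ k, 1 ≤ k → |r k| ≤ δ)
    (hr : Tendsto (fun n : ℕ => r n * log n) atTop (nhds γ)) (x : ℝ) :
    Tendsto (fun n : ℕ => (n : ℝ) * ∑ k ∈ Finset.Icc 1 n, |γ / log n - r k|
      * rexp (-(un n x) ^ 2 / (1 + max |r k| |γ / log n|))) atTop (nhds 0) := by
  obtain ⟨M, hM⟩ := hr.norm.bddAbove_range
  have hM' : ∀ n : ℕ, |r n * log n| ≤ M := fun n => hM ⟨n, rfl⟩
  have hM0 : 0 ≤ M := (abs_nonneg _).trans (hM' 0)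
  set α : ℝ := (1 - δ) / (2 * (1 + δ)) with hα
  have hα0 : 0 < α := div_pos (by linarith) (by linarith)
  set M' : ℝ := max (M / α) γ with hM'def
  have hM'0 : 0 ≤ M' := hγ.trans (le_max_right _ _)
  set K : ℝ := rexp |2 * x - log (4 * π)| with hK
  set b : ℕ → ℝ := fun k => |γ - r k * log k| with hb
  have hb0 : Tendsto (fun n : ℕ => (n : ℝ)⁻¹ * ∑ k ∈ Finset.Icc 1 n, b k) atTop (nhds 0) := by
    have h1 : Tendsto (fun k => b (k + 1)) atTop (nhds 0) := by
      have := ((hr.const_sub γ).abs).comp (tendsto_add_atTop_nat 1)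
      simpa [hb, Function.comp_def] using this
    refine h1.cesaro.congr fun n => ?_
    congr 1
    rw [Finset.range_eq_Ico, Finset.sum_Ico_add' b 0 n 1]
    rfl
  have hmajor : Tendsto (fun n : ℕ => 2 * K * (log n * rexp (-α * log n))
      + K * rexp (2 * M') * ((n : ℝ)⁻¹ * ∑ k ∈ Finset.Icc 1 n, b k)
      + K * rexp (2 * M') * (M' / log n)) atTop (nhds 0) := by
    have h1 : Tendsto (fun n : ℕ => log (n : ℝ) * rexp (-α * log n)) atTop (nhds 0) := by
      have := (tendsto_rpow_mul_exp_neg_mul_atTop_nhds_zero 1 α hα0)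
      simpa [Function.comp_def] using this.comp tendsto_log_natCast
    have h2 : Tendsto (fun n : ℕ => M' / log (n : ℝ)) atTop (nhds 0) :=
      tendsto_log_natCast.const_div_atTop M'
    simpa using ((h1.const_mul (2 * K)).add (hb0.const_mul (K * rexp (2 * M')))).add
      (h2.const_mul (K * rexp (2 * M')))
  refine squeeze_zero' (Eventually.of_forall fun n => ?_) ?_ hmajor
  · positivity
  filter_upwards [eventually_un_bounds x, tendsto_log_natCast.eventually_ge_atTop 1,
    tendsto_log_natCast.eventually_ge_atTop (2 * γ), eventually_gt_atTop 0]
    with n ⟨hu0, hu1, hu2⟩ hL1 hLγ hn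
  set L := log (n : ℝ) with hL
  have hL0 : 0 < L := by linarith
  have hn0 : (0 : ℝ) < n := by exact_mod_cast hn
  have hexpL : rexp L = n := Real.exp_log hn0
  have hγL : |γ / L| ≤ 1 / 2 := by
    rw [abs_of_nonneg (by positivity), div_le_iff₀ hL0]
    linarith
  have hlogL0 : 0 ≤ log L := Real.log_nonneg hL1
  have hK2 : -|2 * x - log (4 * π)| ≤ 2 * x - log (4 * π) := neg_abs_le _
  -- small lags
  have hsmall : ∀ k, 1 ≤ k → |γ / L - r k| * rexp (-(un n x) ^ 2 / (1 + max |r k| |γ / L|))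
      ≤ 2 * K * L * rexp (-(1 + 2 * α) * L) := by
    intro k hk
    have h1 : |γ / L - r k| ≤ 2 := by
      refine (abs_sub _ _).trans ?_
      linarith [hrδ k hk]
    have hmax : max |r k| |γ / L| ≤ δ := max_le (hrδ k hk) (hγL.trans hδ2)
    have hmax0 : 0 ≤ max |r k| |γ / L| := (abs_nonneg _).trans (le_max_left _ _)
    have h2 : -(un n x) ^ 2 / (1 + max |r k| |γ / L|)
        ≤ -(1 + 2 * α) * L + log L + |2 * x - log (4 * π)| := by
      have e1 : -(un n x) ^ 2 / (1 + max |r k| |γ / L|) ≤ -(un n x) ^ 2 / (1 + δ) := by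
        rw [neg_div, neg_div, neg_le_neg_iff]
        gcongr
      have e2 : -(un n x) ^ 2 / (1 + δ)
          ≤ (-(2 * L) + log L + |2 * x - log (4 * π)|) / (1 + δ) := by
        gcongr
        linarith
      have e3 : (1 + 2 * α) = 2 / (1 + δ) := by
        rw [hα]
        field_simp
        ring
      have e4 : (log L + |2 * x - log (4 * π)|) / (1 + δ) ≤ log L + |2 * x - log (4 * π)| :=
        div_le_self (by positivity) (by linarith)
      calc _ ≤ _ := e1
        _ ≤ _ := e2
        _ = -(2 / (1 + δ)) * L + (log L + |2 * x - log (4 * π)|) / (1 + δ) := by ring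
        _ ≤ _ := by rw [e3]; linarith
    have h3 : rexp (-(un n x) ^ 2 / (1 + max |r k| |γ / L|)) ≤ K * L * rexp (-(1 + 2 * α) * L) := by
      refine (Real.exp_le_exp.2 h2).trans (le_of_eq ?_)
      rw [Real.exp_add, Real.exp_add, Real.exp_log hL0]
      ring
    calc _ ≤ 2 * (K * L * rexp (-(1 + 2 * α) * L)) := by gcongr
      _ = _ := by ring
  -- large lags
  have hlarge : ∀ k ∈ Finset.Icc 1 n, α * L < log k →
      |γ / L - r k| * rexp (-(un n x) ^ 2 / (1 + max |r k| |γ / L|))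
      ≤ K * rexp (2 * M') * ((n : ℝ)⁻¹ * (n : ℝ)⁻¹) * (b k + M' / L * (L - log k)) := by
    intro k hk hkα
    obtain ⟨hk1, hkn⟩ := Finset.mem_Icc.1 hk
    have hk0 : (0 : ℝ) < k := by exact_mod_cast hk1
    have hkL : log (k : ℝ) ≤ L := Real.log_le_log hk0 (by exact_mod_cast hkn)
    have hlk : 0 < log (k : ℝ) := lt_trans (by positivity) hkα
    have hrk : |r k| ≤ M' / L := by
      have h1 : |r k| ≤ M / log k := by
        rw [le_div_iff₀ hlk]
        have := hM' k
        rwa [abs_mul, abs_of_pos hlk] at this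
      have h2 : M / log (k : ℝ) ≤ M / (α * L) := by gcongr
      have h3 : M / (α * L) = M / α / L := by field_simp
      have h4 : M / α / L ≤ M' / L := by gcongr; exact le_max_left _ _
      linarith
    have hmax : max |r k| |γ / L| ≤ M' / L := by
      refine max_le hrk ?_
      rw [abs_of_nonneg (by positivity)]
      gcongr
      exact le_max_right _ _
    set m := max |r k| |γ / L| with hm
    have hm0 : 0 ≤ m := (abs_nonneg _).trans (le_max_left _ _)
    have h1 : |γ / L - r k| ≤ L⁻¹ * (b k + M' / L * (L - log k)) := by
      have e : γ / L - r k = L⁻¹ * ((γ - r k * log k) - r k * (L - log k)) := by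
        field_simp
        ring
      rw [e, abs_mul, abs_of_pos (inv_pos.2 hL0)]
      gcongr
      refine (abs_sub _ _).trans ?_
      refine add_le_add le_rfl ?_
      rw [abs_mul, abs_of_nonneg (sub_nonneg.2 hkL)]
      exact mul_le_mul_of_nonneg_right hrk (sub_nonneg.2 hkL)
    have h2 : -(un n x) ^ 2 / (1 + m) ≤ -(2 * L) + log L + |2 * x - log (4 * π)| + 2 * M' := by
      have e1 : -(un n x) ^ 2 / (1 + m) ≤ -(un n x) ^ 2 * (1 - m) := by
        rw [div_le_iff₀ (by linarith)]
        nlinarith [mul_nonneg (sq_nonneg (un n x)) (sq_nonneg m)]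
      have e2 : (un n x) ^ 2 * m ≤ 2 * L * (M' / L) :=
        mul_le_mul hu1 hmax hm0 (by positivity)
      have e3 : 2 * L * (M' / L) = 2 * M' := by field_simp
      linarith
    have h3 : rexp (-(un n x) ^ 2 / (1 + m))
        ≤ K * rexp (2 * M') * ((n : ℝ)⁻¹ * (n : ℝ)⁻¹) * L := by
      refine (Real.exp_le_exp.2 h2).trans (le_of_eq ?_)
      rw [Real.exp_add, Real.exp_add, Real.exp_add, Real.exp_log hL0, Real.exp_neg, two_mul L,
        Real.exp_add, hexpL, mul_inv]
      ring
    calc _ ≤ (L⁻¹ * (b k + M' / L * (L - log k)))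
        * (K * rexp (2 * M') * ((n : ℝ)⁻¹ * (n : ℝ)⁻¹) * L) := by
          gcongr
      _ = _ := by
          field_simp
  have hall : ∀ k ∈ Finset.Icc 1 n,
      |γ / L - r k| * rexp (-(un n x) ^ 2 / (1 + max |r k| |γ / L|))
      ≤ (if log (k : ℝ) ≤ α * L then 2 * K * L * rexp (-(1 + 2 * α) * L) else 0)
        + K * rexp (2 * M') * ((n : ℝ)⁻¹ * (n : ℝ)⁻¹) * (b k + M' / L * (L - log k)) := by
    intro k hk
    obtain ⟨hk1, hkn⟩ := Finset.mem_Icc.1 hk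
    have hk0 : (0 : ℝ) < k := by exact_mod_cast hk1
    have hkL : log (k : ℝ) ≤ L := Real.log_le_log hk0 (by exact_mod_cast hkn)
    split_ifs with h
    · refine (hsmall k hk1).trans (le_add_of_nonneg_right ?_)
      have : 0 ≤ M' / L * (L - log k) := mul_nonneg (by positivity) (by linarith)
      positivity
    · rw [zero_add]
      exact hlarge k hk (not_le.1 h)
  have hcount : ∑ k ∈ Finset.Icc 1 n,
      (if log (k : ℝ) ≤ α * L then 2 * K * L * rexp (-(1 + 2 * α) * L) else 0)
      ≤ rexp (α * L) * (2 * K * L * rexp (-(1 + 2 * α) * L)) := by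
    rw [← Finset.sum_filter, Finset.sum_const, nsmul_eq_mul]
    refine mul_le_mul_of_nonneg_right ?_ (by positivity)
    have hsub : Finset.filter (fun k : ℕ => log (k : ℝ) ≤ α * L) (Finset.Icc 1 n)
        ⊆ Finset.Icc 1 ⌊rexp (α * L)⌋₊ := by
      intro k hk
      obtain ⟨hk, hk2⟩ := Finset.mem_filter.1 hk
      obtain ⟨hk1, hkn⟩ := Finset.mem_Icc.1 hk
      have hk0 : (0 : ℝ) < k := by exact_mod_cast hk1
      refine Finset.mem_Icc.2 ⟨hk1, Nat.le_floor ?_⟩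
      rwa [← Real.log_le_iff_le_exp hk0]
    have := Finset.card_le_card hsub
    rw [Nat.card_Icc, Nat.add_sub_cancel] at this
    exact (Nat.cast_le.2 this).trans (Nat.floor_le (by positivity))
  calc (n : ℝ) * ∑ k ∈ Finset.Icc 1 n, |γ / L - r k|
        * rexp (-(un n x) ^ 2 / (1 + max |r k| |γ / L|))
      ≤ n * (rexp (α * L) * (2 * K * L * rexp (-(1 + 2 * α) * L))
        + K * rexp (2 * M') * ((n : ℝ)⁻¹ * (n : ℝ)⁻¹)
          * (∑ k ∈ Finset.Icc 1 n, b k + M' / L * n)) := by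
        refine mul_le_mul_of_nonneg_left ((Finset.sum_le_sum hall).trans ?_) hn0.le
        rw [Finset.sum_add_distrib, ← Finset.mul_sum, Finset.sum_add_distrib, ← Finset.mul_sum]
        have := sum_log_sub_log_le n
        gcongr
    _ = _ := by
        have e : rexp (-(1 + 2 * α) * L) = (n : ℝ)⁻¹ * (rexp (-α * L) * rexp (-(α * L))) := by
          rw [← hexpL, ← Real.exp_neg, ← Real.exp_add, ← Real.exp_add]
          congr 1
          ring
        have e' : rexp (α * L) * rexp (-(α * L)) = 1 := by
          rw [← Real.exp_add, add_neg_cancel, Real.exp_zero]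
        rw [e]
        have : (n : ℝ) * (rexp (α * L) * (2 * K * L
            * ((n : ℝ)⁻¹ * (rexp (-α * L) * rexp (-(α * L))))))
            = ((n : ℝ) * (n : ℝ)⁻¹) * (2 * K * (L * rexp (-α * L)))
              * (rexp (α * L) * rexp (-(α * L))) := by ring
        rw [mul_add, this, e', mul_inv_cancel₀ hn0.ne']
        field_simp
        ring

lemma hasGaussianLaw_of_forall_sum {Ω ι : Type*} [Fintype ι] [MeasurableSpace Ω] {P : Measure Ω}
    [IsProbabilityMeasure P] {X : ℕ → Ω → ℝ} (hX : ∀ n, Measurable (X n))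
    (hGauss : ∀ (m : ℕ) (idx : Fin m → ℕ) (c : Fin m → ℝ), ∃ v : ℝ≥0,
      Measure.map (fun ω => ∑ i, c i * X (idx i) ω) P = gaussianReal 0 v) (idx : ι → ℕ) :
    HasGaussianLaw (fun ω => fun p => X (idx p) ω) P := by
  have hm : Measurable (fun ω => fun p => X (idx p) ω) := measurable_pi_lambda _ fun p => hX _
  refine ⟨isGaussian_of_map_eq_gaussianReal fun L => ?_⟩
  set e := Fintype.equivFin ι
  obtain ⟨v, hv⟩ := hGauss (Fintype.card ι) (fun i => idx (e.symm i))
    (fun i => L (Pi.single (e.symm i) 1))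
  refine ⟨0, v, ?_⟩
  rw [Measure.map_map L.continuous.measurable hm, ← hv]
  congr 1
  ext ω
  have h1 : L (fun p => X (idx p) ω) = ∑ p, L (Pi.single p 1) * X (idx p) ω := by
    have := L.toLinearMap.pi_apply_eq_sum_univ (fun p => X (idx p) ω)
    simp only [ContinuousLinearMap.coe_coe, smul_eq_mul] at this
    rw [this]
    refine Finset.sum_congr rfl fun p _ => ?_
    rw [mul_comm]
    congr 2
    ext q
    simp [Pi.single_apply, eq_comm]
  rw [Function.comp_apply, h1]
  exact (Equiv.sum_comp e.symm fun p => L (Pi.single p 1) * X (idx p) ω).symm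

lemma integral_mul_eq_of_map_eq {Ω : Type*} [MeasurableSpace Ω] {P : Measure Ω}
    {X : ℕ → Ω → ℝ} (hX : ∀ n, Measurable (X n))
    (hstat : ∀ (m k : ℕ),
      Measure.map (fun ω => fun i : Fin m => X (i.1 + 1 + k) ω) P =
        Measure.map (fun ω => fun i : Fin m => X (i.1 + 1) ω) P) (a k : ℕ) :
    ∫ ω, X (a + 1) ω * X (a + k + 1) ω ∂P = ∫ ω, X 1 ω * X (k + 1) ω ∂P := by
  have h := congrArg (fun μ => ∫ v : Fin (k + 1) → ℝ, v 0 * v (Fin.last k) ∂μ) (hstat (k + 1) a)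
  rw [integral_map (measurable_pi_lambda _ fun _ => hX _).aemeasurable
      (by fun_prop : Measurable fun v : Fin (k + 1) → ℝ => v 0 * v (Fin.last k)).aestronglyMeasurable,
    integral_map (measurable_pi_lambda _ fun _ => hX _).aemeasurable
      (by fun_prop : Measurable fun v : Fin (k + 1) → ℝ => v 0 * v (Fin.last k)).aestronglyMeasurable]
    at h
  simp only [Fin.val_zero, Fin.val_last, zero_add] at h
  rw [← h]
  congr! 4 <;> ring

lemma memLp_two_of_map_eq_gaussianReal {Ω : Type*} [MeasurableSpace Ω] {P : Measure Ω}
    {X : Ω → ℝ} (hX : Measurable X) (h : Measure.map X P = gaussianReal 0 1) : MemLp X 2 P := by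
  have := memLp_id_gaussianReal (μ := 0) (v := 1) 2
  rw [← h] at this
  exact (memLp_map_measure_iff (by fun_prop) hX.aemeasurable).1 this

lemma integral_eq_zero_of_map_eq_gaussianReal {Ω : Type*} [MeasurableSpace Ω] {P : Measure Ω}
    {X : Ω → ℝ} (hX : Measurable X) (h : Measure.map X P = gaussianReal 0 1) :
    ∫ ω, X ω ∂P = 0 := by
  have := integral_id_gaussianReal (μ := 0) (v := 1)
  rwa [← h, integral_map hX.aemeasurable (by fun_prop)] at this

lemma integral_mul_self_of_map_eq_gaussianReal {Ω : Type*} [MeasurableSpace Ω] {P : Measure Ω}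
    [IsProbabilityMeasure P]
    {X : Ω → ℝ} (hX : Measurable X) (h : Measure.map X P = gaussianReal 0 1) :
    ∫ ω, X ω * X ω ∂P = 1 := by
  have h1 : Var[X; P] = 1 := by
    have := variance_id_gaussianReal (μ := 0) (v := 1)
    rw [← h, variance_map (by fun_prop) hX.aemeasurable] at this
    simpa using this
  rw [variance_eq_sub (memLp_two_of_map_eq_gaussianReal hX h),
    integral_eq_zero_of_map_eq_gaussianReal hX h] at h1
  simpa [sq] using h1

/-- The covariances of a stationary standard Gaussian sequence with vanishing correlations are
uniformly bounded away from one. -/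
theorem exists_abs_integral_mul_le {Ω : Type*} [MeasurableSpace Ω] {P : Measure Ω}
    [IsProbabilityMeasure P] {X : ℕ → Ω → ℝ} (hX : ∀ n, Measurable (X n))
    (hstd : ∀ n, Measure.map (X n) P = gaussianReal 0 1)
    (hstat : ∀ (m k : ℕ),
      Measure.map (fun ω => fun i : Fin m => X (i.1 + 1 + k) ω) P =
        Measure.map (fun ω => fun i : Fin m => X (i.1 + 1) ω) P)
    (hr : Tendsto (fun n : ℕ => ∫ ω, X 1 ω * X (n + 1) ω ∂P) atTop (nhds 0)) :
    ∃ δ : ℝ, 1 / 2 ≤ δ ∧ δ < 1 ∧ ∀ k, 1 ≤ k → |∫ ω, X 1 ω * X (k + 1) ω ∂P| ≤ δ := by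
  set r : ℕ → ℝ := fun k => ∫ ω, X 1 ω * X (k + 1) ω ∂P with hrdef
  have hL : ∀ n, MemLp (X n) 2 P := fun n => memLp_two_of_map_eq_gaussianReal (hX n) (hstd n)
  have hint : ∀ m n, Integrable (fun ω => X m ω * X n ω) P := fun m n =>
    (hL m).integrable_mul (hL n)
  have hone : ∀ n, ∫ ω, X n ω * X n ω ∂P = 1 := fun n =>
    integral_mul_self_of_map_eq_gaussianReal (hX n) (hstd n)
  have hsq : ∀ (s : ℝ) (a k : ℕ), ∫ ω, (X (a + k + 1) ω - s * X (a + 1) ω) ^ 2 ∂P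
      = 1 - 2 * s * r k + s ^ 2 := by
    intro s a k
    have e : ∀ ω, (X (a + k + 1) ω - s * X (a + 1) ω) ^ 2 = X (a + k + 1) ω * X (a + k + 1) ω
        - 2 * s * (X (a + 1) ω * X (a + k + 1) ω) + s ^ 2 * (X (a + 1) ω * X (a + 1) ω) := by
      intro ω
      ring
    simp only [e]
    rw [integral_add (by fun_prop (disch := exact hint _ _)) (((hint _ _).const_mul _)),
      integral_sub (hint _ _) ((hint _ _).const_mul _), integral_const_mul, integral_const_mul,
      hone, hone, integral_mul_eq_of_map_eq hX hstat]
    ring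
  have hle : ∀ k, |r k| ≤ 1 := by
    intro k
    have h1 := hsq 1 0 k
    have h2 := hsq (-1) 0 k
    have p1 : 0 ≤ ∫ ω, (X (0 + k + 1) ω - 1 * X (0 + 1) ω) ^ 2 ∂P :=
      integral_nonneg fun _ => sq_nonneg _
    have p2 : 0 ≤ ∫ ω, (X (0 + k + 1) ω - (-1) * X (0 + 1) ω) ^ 2 ∂P :=
      integral_nonneg fun _ => sq_nonneg _
    rw [abs_le]
    constructor <;> linarith
  have hlt : ∀ k, 1 ≤ k → |r k| < 1 := by
    intro k hk
    refine lt_of_le_of_ne (hle k) fun h => ?_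
    have hs : r k ^ 2 = 1 := by rw [← sq_abs, h, one_pow]
    have hae : ∀ a, ∀ᵐ ω ∂P, X (a + k + 1) ω = r k * X (a + 1) ω := by
      intro a
      have h0 := hsq (r k) a k
      have h0' : 1 - 2 * r k * r k + r k ^ 2 = 0 := by linear_combination -hs
      have hi : Integrable (fun ω => (X (a + k + 1) ω - r k * X (a + 1) ω) ^ 2) P :=
        ((hL _).sub ((hL _).const_mul _)).integrable_sq
      rw [h0', integral_eq_zero_iff_of_nonneg (fun _ => sq_nonneg _) hi] at h0
      filter_upwards [h0] with ω hω
      exact sub_eq_zero.1 (pow_eq_zero_iff (two_ne_zero) |>.1 hω)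
    have hpow : ∀ j : ℕ, ∀ᵐ ω ∂P, X (j * k + 1) ω = r k ^ j * X 1 ω := by
      intro j
      induction j with
      | zero => simp
      | succ j ih =>
        filter_upwards [ih, hae (j * k)] with ω h1 h2
        rw [add_mul, one_mul, h2, h1]
        ring
    have hrj : ∀ j, |r (j * k)| = 1 := by
      intro j
      have : r (j * k) = r k ^ j := by
        calc r (j * k) = ∫ ω, r k ^ j * (X 1 ω * X 1 ω) ∂P := by
              refine integral_congr_ae ?_
              filter_upwards [hpow j] with ω hω
              rw [hω]
              ring
          _ = _ := by rw [integral_const_mul, hone, mul_one]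
      rw [this, abs_pow, h, one_pow]
    have ht : Tendsto (fun j : ℕ => |r (j * k)|) atTop (nhds 0) := by
      have h1 : Tendsto (fun j : ℕ => j * k) atTop atTop :=
        tendsto_id.atTop_mul_const' hk
      simpa using (hr.comp h1).abs
    simp only [hrj] at ht
    exact one_ne_zero (tendsto_nhds_unique tendsto_const_nhds ht)
  have hev : ∀ᶠ n in atTop, |r n| ≤ 1 / 2 := by
    have : Tendsto (fun n => |r n|) atTop (nhds 0) := by simpa using hr.abs
    exact this.eventually_le_const (by norm_num)
  obtain ⟨N, hN⟩ := eventually_atTop.1 hev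
  have hfin : ∀ N : ℕ, ∃ δ : ℝ, 1 / 2 ≤ δ ∧ δ < 1 ∧ ∀ k, 1 ≤ k → k < N → |r k| ≤ δ := by
    intro N
    induction N with
    | zero => exact ⟨1 / 2, le_rfl, by norm_num, by simp⟩
    | succ N ih =>
      obtain ⟨δ, h1, h2, h3⟩ := ih
      rcases Nat.eq_zero_or_pos N with rfl | hN0
      · exact ⟨δ, h1, h2, fun k hk hk' => absurd hk (by omega)⟩
      · refine ⟨max δ |r N|, h1.trans (le_max_left _ _), max_lt h2 (hlt N hN0), fun k hk hk' => ?_⟩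
        rcases Nat.lt_succ_iff_lt_or_eq.1 hk' with h | rfl
        · exact (h3 k hk h).trans (le_max_left _ _)
        · exact le_max_right _ _
  obtain ⟨δ, h1, h2, h3⟩ := hfin N
  refine ⟨δ, h1, h2, fun k hk => ?_⟩
  rcases lt_or_ge k N with h | h
  · exact h3 k hk h
  · exact (hN k h).trans h1

lemma isGaussian_pi_gaussianReal {ι : Type*} [Fintype ι] :
    IsGaussian (Measure.pi fun _ : ι => gaussianReal 0 1) := by
  have h : HasGaussianLaw (fun (w : ι → ℝ) p => w p) (Measure.pi fun _ : ι => gaussianReal 0 1) := by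
    refine iIndepFun.hasGaussianLaw (X := fun (p : ι) (w : ι → ℝ) => w p) (fun p => ⟨?_⟩)
      (iIndepFun_pi (X := fun _ x => x) fun _ => aemeasurable_id)
    rw [(measurePreserving_eval (fun _ : ι => gaussianReal 0 1) p).map_eq]
    infer_instance
  have := h.isGaussian_map
  rwa [Measure.map_id'] at this

/-- The product space carrying a random vector, an independent standard Gaussian variable and
an independent standard Gaussian vector. -/
noncomputable abbrev extendedMeasure {Ω : Type*} [MeasurableSpace Ω] (P : Measure Ω) (ι : Type*)
    [Fintype ι] : Measure (Ω × ℝ × (ι → ℝ)) :=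
  P.prod ((gaussianReal 0 1).prod (Measure.pi fun _ : ι => gaussianReal 0 1))

section Extended

variable {Ω ι : Type*} [Fintype ι] [MeasurableSpace Ω] {P : Measure Ω} [IsProbabilityMeasure P]

lemma hasGaussianLaw_extendedMeasure {X : ι → Ω → ℝ} (hX : ∀ p, Measurable (X p))
    (h : HasGaussianLaw (fun ω => fun p => X p ω) P) (a b : ℝ) :
    HasGaussianLaw (fun q : Ω × ℝ × (ι → ℝ) =>
      (fun p => X p q.1, fun p => a * q.2.1 + b * q.2.2 p)) (extendedMeasure P ι) := by
  have := h.isGaussian_map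
  have := isGaussian_pi_gaussianReal (ι := ι)
  have hm : Measurable (fun ω => fun p => X p ω) := measurable_pi_lambda _ hX
  have h1 : HasGaussianLaw (fun q : Ω × ℝ × (ι → ℝ) => (fun p => X p q.1, q.2))
      (extendedMeasure P ι) := by
    refine ⟨?_⟩
    have e : (P.map fun ω => fun p => X p ω).prod
        ((gaussianReal 0 1).prod (Measure.pi fun _ : ι => gaussianReal 0 1))
        = Measure.map (fun q : Ω × ℝ × (ι → ℝ) => (fun p => X p q.1, q.2))
          (extendedMeasure P ι) := by
      have := Measure.map_prod_map P
        ((gaussianReal 0 1).prod (Measure.pi fun _ : ι => gaussianReal 0 1)) hm measurable_id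
      rw [Measure.map_id] at this
      exact this
    rw [← e]
    infer_instance
  let L : (ι → ℝ) × ℝ × (ι → ℝ) →L[ℝ] (ι → ℝ) × (ι → ℝ) :=
    (ContinuousLinearMap.fst ℝ _ _).prod (ContinuousLinearMap.pi fun p =>
      a • ((ContinuousLinearMap.fst ℝ _ _).comp (ContinuousLinearMap.snd ℝ _ _))
      + b • ((ContinuousLinearMap.proj p).comp ((ContinuousLinearMap.snd ℝ _ _).comp
        (ContinuousLinearMap.snd ℝ _ _))))
  exact h1.map_fun L

lemma measurePreserving_snd_fst_extendedMeasure : MeasurePreserving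
    (fun q : Ω × ℝ × (ι → ℝ) => q.2.1) (extendedMeasure P ι) (gaussianReal 0 1) :=
  measurePreserving_fst.comp measurePreserving_snd

lemma measurePreserving_snd_snd_extendedMeasure (p : ι) : MeasurePreserving
    (fun q : Ω × ℝ × (ι → ℝ) => q.2.2 p) (extendedMeasure P ι) (gaussianReal 0 1) :=
  (measurePreserving_eval (fun _ : ι => gaussianReal 0 1) p).comp
    (measurePreserving_snd.comp measurePreserving_snd)

lemma MeasureTheory.MeasurePreserving.memLp_two_gaussianReal {Ω : Type*} [MeasurableSpace Ω]
    {Q : Measure Ω} {f : Ω → ℝ} (h : MeasurePreserving f Q (gaussianReal 0 1)) : MemLp f 2 Q :=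
  memLp_two_of_map_eq_gaussianReal h.measurable h.map_eq

lemma MeasureTheory.MeasurePreserving.covariance_self_gaussianReal {Ω : Type*} [MeasurableSpace Ω]
    {Q : Measure Ω} {f : Ω → ℝ} (h : MeasurePreserving f Q (gaussianReal 0 1)) :
    cov[f, f; Q] = 1 := by
  rw [covariance_self h.measurable.aemeasurable]
  have := variance_id_gaussianReal (μ := 0) (v := 1)
  rw [← h.map_eq, variance_map (by fun_prop) h.measurable.aemeasurable] at this
  simpa using this

lemma covariance_extendedMeasure [DecidableEq ι] (a b : ℝ) (p p' : ι) :
    cov[fun q : Ω × ℝ × (ι → ℝ) => a * q.2.1 + b * q.2.2 p,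
      fun q => a * q.2.1 + b * q.2.2 p'; extendedMeasure P ι]
      = a ^ 2 + if p = p' then b ^ 2 else 0 := by
  set Z : Ω × ℝ × (ι → ℝ) → ℝ := fun q => q.2.1 with hZ
  set ξ : ι → Ω × ℝ × (ι → ℝ) → ℝ := fun p q => q.2.2 p with hξ
  have mZ : MeasurePreserving Z (extendedMeasure P ι) (gaussianReal 0 1) :=
    measurePreserving_snd_fst_extendedMeasure
  have mξ : ∀ p, MeasurePreserving (ξ p) (extendedMeasure P ι) (gaussianReal 0 1) :=
    fun p => measurePreserving_snd_snd_extendedMeasure p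
  have lZ := mZ.memLp_two_gaussianReal
  have lξ := fun p => (mξ p).memLp_two_gaussianReal
  have c0 : cov[Z, Z; extendedMeasure P ι] = 1 := mZ.covariance_self_gaussianReal
  have c1 : ∀ p, cov[Z, ξ p; extendedMeasure P ι] = 0 := by
    intro p
    have hi : (fun w : ℝ × (ι → ℝ) => w.1) ⟂ᵢ[(gaussianReal 0 1).prod
        (Measure.pi fun _ : ι => gaussianReal 0 1)] (fun w => w.2 p) :=
      indepFun_prod (X := fun x => x) (Y := fun w : ι → ℝ => w p) measurable_id
        (measurable_pi_apply p)
    have h2 := hi.covariance_eq_zero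
      (measurePreserving_fst (μ := gaussianReal 0 1)).memLp_two_gaussianReal
      ((measurePreserving_eval (fun _ : ι => gaussianReal 0 1) p).comp
        measurePreserving_snd).memLp_two_gaussianReal
    rw [← (measurePreserving_snd (μ := P) (ν := (gaussianReal 0 1).prod
      (Measure.pi fun _ : ι => gaussianReal 0 1))).map_eq,
      covariance_map_fun (by fun_prop) (by fun_prop) (by fun_prop)] at h2
    exact h2
  have c2 : cov[ξ p, ξ p'; extendedMeasure P ι] = if p = p' then 1 else 0 := by
    split_ifs with h
    · subst h
      exact (mξ p).covariance_self_gaussianReal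
    · have hi := (iIndepFun_pi (μ := fun _ : ι => gaussianReal 0 1) (X := fun _ x => x)
        fun _ => aemeasurable_id).indepFun h
      have h2 := hi.covariance_eq_zero
        (measurePreserving_eval (fun _ : ι => gaussianReal 0 1) p).memLp_two_gaussianReal
        (measurePreserving_eval (fun _ : ι => gaussianReal 0 1) p').memLp_two_gaussianReal
      rw [← (measurePreserving_snd.comp measurePreserving_snd :
        MeasurePreserving (fun q : Ω × ℝ × (ι → ℝ) => q.2.2) (extendedMeasure P ι) _).map_eq,
        covariance_map_fun (measurable_pi_apply p).aestronglyMeasurable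
          (measurable_pi_apply p').aestronglyMeasurable (by fun_prop)] at h2
      exact h2
  have e : ∀ p, (fun q : Ω × ℝ × (ι → ℝ) => a * q.2.1 + b * q.2.2 p) = a • Z + b • ξ p :=
    fun p => rfl
  rw [e, e, covariance_add_left (lZ.const_smul a) ((lξ p).const_smul b)
      ((lZ.const_smul a).add ((lξ p').const_smul b)),
    covariance_add_right (lZ.const_smul a) (lZ.const_smul a) ((lξ p').const_smul b),
    covariance_add_right ((lξ p).const_smul b) (lZ.const_smul a) ((lξ p').const_smul b)]
  simp only [covariance_smul_left, covariance_smul_right, c0, c1, c2,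
    covariance_comm (ξ p) Z]
  split_ifs <;> ring

lemma covariance_fst_extendedMeasure {f : Ω → ℝ} (hf : MemLp f 2 P) (hfm : Measurable f)
    (a b : ℝ) (p : ι) :
    cov[fun q : Ω × ℝ × (ι → ℝ) => f q.1, fun q => a * q.2.1 + b * q.2.2 p;
      extendedMeasure P ι] = 0 := by
  have hi : (fun q : Ω × ℝ × (ι → ℝ) => f q.1) ⟂ᵢ[extendedMeasure P ι]
      (fun q => a * q.2.1 + b * q.2.2 p) :=
    indepFun_prod (X := f) (Y := fun w : ℝ × (ι → ℝ) => a * w.1 + b * w.2 p) hfm (by fun_prop)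
  refine hi.covariance_eq_zero (hf.comp_measurePreserving measurePreserving_fst) ?_
  exact (measurePreserving_snd_fst_extendedMeasure.memLp_two_gaussianReal.const_mul a).add
    ((measurePreserving_snd_snd_extendedMeasure p).memLp_two_gaussianReal.const_mul b)

lemma extendedMeasure_real_setOf_forall_le (a : ℝ) {b : ℝ} (hb : 0 < b) (l : ι → ℝ) :
    (extendedMeasure P ι).real {q | ∀ p, a * q.2.1 + b * q.2.2 p ≤ l p}
      = ∫ z, ∏ p, (gaussianReal 0 1).real (Set.Iic ((l p - a * z) / b)) ∂(gaussianReal 0 1) := by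
  set S : Set (ℝ × (ι → ℝ)) := {w | ∀ p, a * w.1 + b * w.2 p ≤ l p} with hS
  have hSm : MeasurableSet S := by
    rw [hS, Set.ofPred_forall]
    exact MeasurableSet.iInter fun p => measurableSet_le (by fun_prop) (by fun_prop)
  have h1 : (extendedMeasure P ι) {q | ∀ p, a * q.2.1 + b * q.2.2 p ≤ l p}
      = ((gaussianReal 0 1).prod (Measure.pi fun _ : ι => gaussianReal 0 1)) S :=
    measurePreserving_snd.measure_preimage hSm.nullMeasurableSet
  rw [measureReal_def, h1, Measure.prod_apply hSm, ← integral_toReal]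
  · refine integral_congr_ae (Eventually.of_forall fun z => ?_)
    have : Prod.mk z ⁻¹' S = Set.pi Set.univ fun p => Set.Iic ((l p - a * z) / b) := by
      ext w
      simp only [hS, Set.mem_preimage, Set.mem_ofPred_eq, Set.mem_pi, Set.mem_univ,
        forall_const, Set.mem_Iic]
      refine forall_congr' fun p => ?_
      rw [le_div_iff₀ hb]
      constructor <;> intro h <;> linarith
    simp only [this, Measure.pi_pi, ENNReal.toReal_prod, measureReal_def]
  · exact (measurable_measure_prodMk_left hSm).aemeasurable
  · exact Eventually.of_forall fun z => measure_lt_top _ _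

end Extended

lemma sum_sum_erase_le {ι : Type*} [Fintype ι] [DecidableEq ι] {n : ℕ} {idx : ι → ℕ}
    (hinj : Function.Injective idx) (hidx : ∀ p, idx p ∈ Finset.Icc 1 n) {F : ℕ → ℝ}
    (hF : ∀ k, 0 ≤ F k) :
    ∑ p, ∑ q ∈ Finset.univ.erase p, F ((idx p - idx q) + (idx q - idx p))
      ≤ 2 * (n * ∑ k ∈ Finset.Icc 1 n, F k) := by
  have hS : 0 ≤ ∑ k ∈ Finset.Icc 1 n, F k := Finset.sum_nonneg fun k _ => hF k
  have hcard : (Fintype.card ι : ℝ) ≤ n := by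
    have h1 := Finset.card_le_card_of_injOn (s := Finset.univ) idx (fun p _ => hidx p)
      hinj.injOn
    rw [Nat.card_Icc, Nat.add_sub_cancel, Finset.card_univ] at h1
    exact_mod_cast h1
  have hrow : ∀ p, ∑ q ∈ Finset.univ.erase p, F ((idx p - idx q) + (idx q - idx p))
      ≤ 2 * ∑ k ∈ Finset.Icc 1 n, F k := by
    intro p
    have hp := Finset.mem_Icc.1 (hidx p)
    have hne : ∀ q ∈ Finset.univ.erase p, idx q ≠ idx p := fun q hq h =>
      (Finset.mem_erase.1 hq).1 (hinj h)
    rw [← Finset.sum_filter_add_sum_filter_not _ (fun q => idx q < idx p), two_mul]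
    refine add_le_add ?_ ?_
    · rw [← Finset.sum_image (s := Finset.filter (fun q => idx q < idx p) (Finset.univ.erase p))
        (f := F) (g := fun q => (idx p - idx q) + (idx q - idx p))]
      · refine Finset.sum_le_sum_of_subset_of_nonneg ?_ fun k _ _ => hF k
        intro k hk
        obtain ⟨q, hq, rfl⟩ := Finset.mem_image.1 hk
        have h1 := (Finset.mem_filter.1 hq).2
        have h2 := Finset.mem_Icc.1 (hidx q)
        exact Finset.mem_Icc.2 ⟨by omega, by omega⟩
      · intro q hq q' hq' h
        have h1 := (Finset.mem_filter.1 hq).2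
        have h2 := (Finset.mem_filter.1 hq').2
        simp only at h
        exact hinj (by omega)
    · rw [← Finset.sum_image (s := Finset.filter (fun q => ¬ idx q < idx p) (Finset.univ.erase p))
        (f := F) (g := fun q => (idx p - idx q) + (idx q - idx p))]
      · refine Finset.sum_le_sum_of_subset_of_nonneg ?_ fun k _ _ => hF k
        intro k hk
        obtain ⟨q, hq, rfl⟩ := Finset.mem_image.1 hk
        have h1 := (Finset.mem_filter.1 hq).2
        have h2 := Finset.mem_Icc.1 (hidx q)
        have h3 := hne q (Finset.mem_filter.1 hq).1
        exact Finset.mem_Icc.2 ⟨by omega, by omega⟩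
      · intro q hq q' hq' h
        have h1 := (Finset.mem_filter.1 hq).2
        have h2 := (Finset.mem_filter.1 hq').2
        simp only at h
        exact hinj (by omega)
  calc _ ≤ ∑ _p : ι, 2 * ∑ k ∈ Finset.Icc 1 n, F k := Finset.sum_le_sum fun p _ => hrow p
    _ = Fintype.card ι * (2 * ∑ k ∈ Finset.Icc 1 n, F k) := by
      rw [Finset.sum_const, Finset.card_univ, nsmul_eq_mul]
    _ ≤ n * (2 * ∑ k ∈ Finset.Icc 1 n, F k) := by gcongr
    _ = _ := by ring

/-- Comparison of a stationary standard Gaussian sequence with an equicorrelated one. -/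
theorem exists_equicorrelated_comparison {Ω : Type} [MeasurableSpace Ω] {P : Measure Ω}
    [IsProbabilityMeasure P] {X : ℕ → Ω → ℝ} (hX : ∀ n, Measurable (X n))
    (hGauss : ∀ (m : ℕ) (idx : Fin m → ℕ) (c : Fin m → ℝ), ∃ v : ℝ≥0,
      Measure.map (fun ω => ∑ i, c i * X (idx i) ω) P = gaussianReal 0 v)
    (hstd : ∀ n, Measure.map (X n) P = gaussianReal 0 1)
    (hstat : ∀ (m k : ℕ),
      Measure.map (fun ω => fun i : Fin m => X (i.1 + 1 + k) ω) P =
        Measure.map (fun ω => fun i : Fin m => X (i.1 + 1) ω) P)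
    {r : ℕ → ℝ} (hr : ∀ n, r n = ∫ ω, X 1 ω * X (n + 1) ω ∂P)
    {δ : ℝ} (hδ2 : 1 / 2 ≤ δ) (hδ : δ < 1) (hrδ : ∀ k, 1 ≤ k → |r k| ≤ δ) :
    ∃ C : ℝ, 0 ≤ C ∧ ∀ {ι : Type} [Fintype ι] {n : ℕ} {idx : ι → ℕ}, Function.Injective idx →
      (∀ p, idx p ∈ Finset.Icc 1 n) → ∀ {ρ u : ℝ} {l : ι → ℝ}, 0 ≤ ρ → ρ ≤ 1 / 2 → 0 ≤ u →
      (∀ p, u ≤ l p) →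
      |∫ z, ∏ p, (gaussianReal 0 1).real (Set.Iic ((l p - √ρ * z) / √(1 - ρ))) ∂(gaussianReal 0 1)
        - P.real {ω | ∀ p, X (idx p) ω ≤ l p}|
      ≤ C * (n * ∑ k ∈ Finset.Icc 1 n, |ρ - r k| * rexp (-u ^ 2 / (1 + max |r k| |ρ|))) := by
  obtain ⟨C, hC0, hC⟩ := exists_normal_comparison (by linarith : 0 ≤ δ) hδ
  refine ⟨C * 2, by positivity, ?_⟩
  intro ι _ n idx hinj hidx ρ u l hρ0 hρ hu hl
  set Q := extendedMeasure P ι with hQ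
  set X' : ι → Ω × ℝ × (ι → ℝ) → ℝ := fun p q => X (idx p) q.1 with hX'
  set Y' : ι → Ω × ℝ × (ι → ℝ) → ℝ := fun p q => √ρ * q.2.1 + √(1 - ρ) * q.2.2 p with hY'
  have hL : ∀ n, MemLp (X n) 2 P := fun n => memLp_two_of_map_eq_gaussianReal (hX n) (hstd n)
  have hmean : ∀ n, ∫ ω, X n ω ∂P = 0 := fun n =>
    integral_eq_zero_of_map_eq_gaussianReal (hX n) (hstd n)
  have hsq1 : √ρ ^ 2 = ρ := Real.sq_sqrt hρ0
  have hsq2 : √(1 - ρ) ^ 2 = 1 - ρ := Real.sq_sqrt (by linarith)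
  have hfst : Q.map Prod.fst = P := (measurePreserving_fst (μ := P)).map_eq
  have hXQ : ∀ p, MeasurePreserving (X' p) Q (gaussianReal 0 1) := fun p =>
    (⟨hX _, hstd _⟩ : MeasurePreserving (X (idx p)) P (gaussianReal 0 1)).comp measurePreserving_fst
  have hcovP : ∀ m m', 1 ≤ m → m < m' → cov[X m, X m'; P] = r (m' - m) := by
    intro m m' hm hmm
    rw [covariance_eq_sub (hL _) (hL _), hmean, zero_mul, sub_zero, hr,
      ← integral_mul_eq_of_map_eq hX hstat (m - 1)]
    have e1 : m - 1 + 1 = m := by omega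
    have e2 : m - 1 + (m' - m) + 1 = m' := by omega
    rw [e1, e2]
    rfl
  have hcovXP : ∀ p q, cov[X' p, X' q; Q] = cov[X (idx p), X (idx q); P] := by
    intro p q
    have := covariance_map_fun (μ := Q) (Z := Prod.fst) (X := X (idx p)) (Y := X (idx q))
      (hX _).aestronglyMeasurable (hX _).aestronglyMeasurable measurable_fst.aemeasurable
    rw [hfst] at this
    exact this.symm
  have hcovX : ∀ p q, p ≠ q → cov[X' p, X' q; Q] = r ((idx p - idx q) + (idx q - idx p)) := by
    intro p q hpq
    rw [hcovXP]
    have hp := (Finset.mem_Icc.1 (hidx p)).1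
    have hq := (Finset.mem_Icc.1 (hidx q)).1
    rcases lt_or_gt_of_ne (fun h => hpq (hinj h)) with h | h
    · rw [hcovP _ _ hp h]
      congr 1
      omega
    · rw [covariance_comm, hcovP _ _ hq h]
      congr 1
      omega
  have hcovY : ∀ p q, p ≠ q → cov[Y' p, Y' q; Q] = ρ := by
    intro p q hpq
    have := covariance_extendedMeasure (P := P) (√ρ) (√(1 - ρ)) p q
    rw [if_neg hpq, hsq1, add_zero] at this
    exact this
  have hmeanY : ∀ p, ∫ q, Y' p q ∂Q = 0 := by
    intro p
    have mZ := measurePreserving_snd_fst_extendedMeasure (P := P) (ι := ι)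
    have mξ := measurePreserving_snd_snd_extendedMeasure (P := P) p
    have h1 := integral_eq_zero_of_map_eq_gaussianReal mZ.measurable mZ.map_eq
    have h2 := integral_eq_zero_of_map_eq_gaussianReal mξ.measurable mξ.map_eq
    simp only [hY', hQ]
    rw [integral_add ((mZ.memLp_two_gaussianReal.integrable (by norm_num)).const_mul _)
      ((mξ.memLp_two_gaussianReal.integrable (by norm_num)).const_mul _),
      integral_const_mul, integral_const_mul, h1, h2]
    simp
  have key := hC (Q := Q) (X := X') (Y := Y')
    (hasGaussianLaw_extendedMeasure (fun p => hX _)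
      (hasGaussianLaw_of_forall_sum hX hGauss idx) _ _)
    (fun p => integral_eq_zero_of_map_eq_gaussianReal (hXQ p).measurable (hXQ p).map_eq)
    hmeanY (fun p => (hXQ p).covariance_self_gaussianReal)
    (fun p => by
      have := covariance_extendedMeasure (P := P) (√ρ) (√(1 - ρ)) p p
      rw [if_pos rfl, hsq1, hsq2, add_sub_cancel] at this
      exact this)
    (fun p q => covariance_fst_extendedMeasure (hL _) (hX _) _ _ _)
    (m := fun p q => max |r ((idx p - idx q) + (idx q - idx p))| |ρ|)
    (fun p q hpq => by rw [hcovX p q hpq]; exact le_max_left _ _)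
    (fun p q hpq => by rw [hcovY p q hpq]; exact le_max_right _ _)
    (fun p q hpq => by
      refine max_le (hrδ _ ?_) ?_
      · have : idx p ≠ idx q := fun h => hpq (hinj h)
        omega
      · rw [abs_of_nonneg hρ0]
        linarith)
    hu hl
  have hYreal : Q.real {q | ∀ p, Y' p q ≤ l p} = _ :=
    extendedMeasure_real_setOf_forall_le (P := P) (√ρ)
      (Real.sqrt_pos.2 (by linarith : 0 < 1 - ρ)) l
  have hXreal : Q.real {q | ∀ p, X' p q ≤ l p} = P.real {ω | ∀ p, X (idx p) ω ≤ l p} := by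
    have hm : MeasurableSet {ω | ∀ p, X (idx p) ω ≤ l p} := by
      rw [Set.ofPred_forall]
      exact MeasurableSet.iInter fun p => measurableSet_le (hX _) measurable_const
    rw [measureReal_def, measureReal_def]
    congr 1
    exact measurePreserving_fst.measure_preimage hm.nullMeasurableSet
  rw [hYreal, hXreal] at key
  refine key.trans ?_
  rw [mul_assoc]
  refine mul_le_mul_of_nonneg_left ?_ hC0
  refine le_trans (le_of_eq ?_) (sum_sum_erase_le hinj hidx
    (F := fun k => |ρ - r k| * rexp (-u ^ 2 / (1 + max |r k| |ρ|))) fun k => by positivity)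
  refine Finset.sum_congr rfl fun p _ => Finset.sum_congr rfl fun q hq => ?_
  have hpq : p ≠ q := (Finset.mem_erase.1 hq).1.symm
  rw [hcovX p q hpq, hcovY p q hpq]

lemma gaussianReal_real_Ioi (v : ℝ) {a : ℝ} (ha : 0 < a) :
    (gaussianReal 0 1).real (Set.Ioi v)
      = a⁻¹ * ∫ s in Set.Ioi 0, (√(2 * π))⁻¹ * rexp (-(v + a⁻¹ * s) ^ 2 / 2) := by
  have h0 : (gaussianReal 0 1).real (Set.Ioi v)
      = ∫ t, (Set.Ioi v).indicator (fun t => (√(2 * π))⁻¹ * rexp (-t ^ 2 / 2)) t := by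
    rw [measureReal_def, gaussianReal_apply_eq_integral 0 one_ne_zero, ENNReal.toReal_ofReal
      (setIntegral_nonneg measurableSet_Ioi fun t _ => gaussianPDFReal_nonneg 0 1 t),
      integral_indicator measurableSet_Ioi]
    simp [gaussianPDFReal]
  rw [h0, ← integral_add_left_eq_self _ v]
  have h1 := Measure.integral_comp_mul_left
    (fun t => (Set.Ioi v).indicator (fun t => (√(2 * π))⁻¹ * rexp (-t ^ 2 / 2)) (v + t)) a⁻¹
  rw [inv_inv, abs_of_pos ha, smul_eq_mul] at h1
  rw [← integral_indicator measurableSet_Ioi]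
  have h2 : ∀ s, (Set.Ioi v).indicator (fun t => (√(2 * π))⁻¹ * rexp (-t ^ 2 / 2)) (v + a⁻¹ * s)
      = (Set.Ioi 0).indicator (fun s => (√(2 * π))⁻¹ * rexp (-(v + a⁻¹ * s) ^ 2 / 2)) s := by
    intro s
    have hiff : v + a⁻¹ * s ∈ Set.Ioi v ↔ s ∈ Set.Ioi (0 : ℝ) := by
      simp only [Set.mem_Ioi, lt_add_iff_pos_right]
      exact mul_pos_iff_of_pos_left (inv_pos.2 ha)
    by_cases h : s ∈ Set.Ioi (0 : ℝ)
    · rw [Set.indicator_of_mem h, Set.indicator_of_mem (hiff.2 h)]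
    · rw [Set.indicator_of_notMem h, Set.indicator_of_notMem (fun h' => h (hiff.1 h'))]
  simp only [h2] at h1
  rw [h1]
  field_simp

/-- The Gaussian tail at the level `un n x`. -/
lemma natCast_mul_gaussianReal_real_Ioi_un {n : ℕ} (hn : 0 < log (n : ℝ)) (x : ℝ) :
    (n : ℝ) * (gaussianReal 0 1).real (Set.Ioi (un n x)) = rexp (-x) * ∫ s in Set.Ioi 0,
      rexp (-s) * rexp (-(((x - (log (log n) + log (4 * π)) / 2) / √(2 * log n)
        + s / √(2 * log n)) ^ 2 / 2)) := by
  have hn0 : (0 : ℝ) < n := by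
    rcases Nat.eq_zero_or_pos n with rfl | h
    · simp at hn
    · exact_mod_cast h
  set L := log (n : ℝ) with hL
  set a := √(2 * L) with ha
  have ha0 : 0 < a := Real.sqrt_pos.2 (by linarith)
  have ha2 : a ^ 2 = 2 * L := Real.sq_sqrt (by linarith)
  set t := x - (log L + log (4 * π)) / 2 with ht
  have hu : un n x = a + t / a := un_eq n x
  rw [gaussianReal_real_Ioi _ ha0, ← mul_assoc, ← integral_const_mul, ← integral_const_mul]
  refine integral_congr_ae (Eventually.of_forall fun s => ?_)
  simp only
  have e1 : -(un n x + a⁻¹ * s) ^ 2 / 2 = -L + (-t + (-s + -((t / a + s / a) ^ 2 / 2))) := by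
    have hLa : L = a ^ 2 / 2 := by linarith
    rw [hu, hLa]
    field_simp
    ring
  have e2 : rexp (-t) = rexp (-x) * (√(2 * π) * a) := by
    have h1 : √(2 * π) * a = rexp ((log L + log (4 * π)) / 2) := by
      rw [ha, ← Real.sqrt_mul (by positivity), ← Real.log_mul hn.ne' (by positivity),
        Real.exp_half, Real.exp_log (by positivity)]
      congr 1
      ring
    rw [h1, ← Real.exp_add]
    congr 1
    rw [ht]
    ring
  have e3 : rexp (-L) = (n : ℝ)⁻¹ := by rw [Real.exp_neg, hL, Real.exp_log hn0]
  have hp : 0 < √(2 * π) := by positivity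
  rw [e1, Real.exp_add, Real.exp_add, Real.exp_add, e2, e3]
  field_simp

lemma tendsto_log_div_sqrt_atTop : Tendsto (fun L => log L / √(2 * L)) atTop (nhds 0) := by
  have h := (isLittleO_log_rpow_atTop (r := 1 / 2) (by norm_num)).tendsto_div_nhds_zero
  have h2 := h.mul_const (√2)⁻¹
  rw [zero_mul] at h2
  refine h2.congr fun L => ?_
  rw [← Real.sqrt_eq_rpow, Real.sqrt_mul (by norm_num), mul_comm (√2), ← div_div, div_eq_mul_inv _ (√2)]

lemma tendsto_natCast_mul_gaussianReal_real_Ioi_un {x' : ℕ → ℝ} {x : ℝ}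
    (hx : Tendsto x' atTop (nhds x)) :
    Tendsto (fun n : ℕ => (n : ℝ) * (gaussianReal 0 1).real (Set.Ioi (un n (x' n)))) atTop
      (nhds (rexp (-x))) := by
  have hsqrt : Tendsto (fun n : ℕ => √(2 * log (n : ℝ))) atTop atTop :=
    Real.tendsto_sqrt_atTop.comp (tendsto_log_natCast.const_mul_atTop (by norm_num))
  have ht : Tendsto (fun n : ℕ => (x' n - (log (log n) + log (4 * π)) / 2) / √(2 * log n)) atTop
      (nhds 0) := by
    have h1 := (hx.sub_const (log (4 * π) / 2)).div_atTop hsqrt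
    have h2 := (tendsto_log_div_sqrt_atTop.comp tendsto_log_natCast).div_const 2
    have h3 := h1.sub h2
    rw [zero_div, sub_zero] at h3
    refine h3.congr fun n => ?_
    simp only [Function.comp_apply]
    ring
  have hint : Tendsto (fun n : ℕ => ∫ s in Set.Ioi (0 : ℝ),
      rexp (-s) * rexp (-(((x' n - (log (log n) + log (4 * π)) / 2) / √(2 * log n)
        + s / √(2 * log n)) ^ 2 / 2))) atTop (nhds (∫ s in Set.Ioi (0 : ℝ), rexp (-s))) := by
    refine tendsto_integral_of_dominated_convergence (fun s => rexp (-s))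
      (fun n => by fun_prop) (integrableOn_exp_neg_Ioi 0) (fun n => ?_) ?_
    · refine Eventually.of_forall fun s => ?_
      rw [Real.norm_of_nonneg (by positivity)]
      refine mul_le_of_le_one_right (by positivity) (Real.exp_le_one_iff.2 ?_)
      rw [neg_nonpos]
      positivity
    · refine Eventually.of_forall fun s => ?_
      have h1 := (ht.add (hsqrt.const_div_atTop s)).pow 2
      have h2 := (Real.continuous_exp.tendsto _).comp (h1.div_const 2).neg
      simpa using h2.const_mul (rexp (-s))
  rw [integral_exp_neg_Ioi_zero] at hint
  have h := ((Real.continuous_exp.tendsto _).comp hx.neg).mul hint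
  rw [mul_one] at h
  refine h.congr' ?_
  filter_upwards [tendsto_log_natCast.eventually_gt_atTop 0] with n hn
  exact (natCast_mul_gaussianReal_real_Ioi_un hn _).symm

/-- Level obtained from `un n x` by conditioning an equicorrelated sequence on its common part. -/
noncomputable def shiftedLevel (γ : ℝ) (n : ℕ) (x z : ℝ) : ℝ :=
  (un n x - √(γ / log n) * z) / √(1 - γ / log n)

lemma tendsto_natCast_mul_log_shiftedLevel (γ x z : ℝ) :
    Tendsto (fun n : ℕ => (n : ℝ) * log ((gaussianReal 0 1).real
      (Set.Iic (shiftedLevel γ n x z)))) atTop (nhds (-g γ x z)) := by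
  set x' : ℕ → ℝ := fun n => (x + (2 * γ - γ * (log (log n) + log (4 * π)) / (2 * log n))
    / (1 + √(1 - γ / log n)) - √(2 * γ) * z) / √(1 - γ / log n) with hx'
  have hρ : Tendsto (fun n : ℕ => √(1 - γ / log (n : ℝ))) atTop (nhds 1) := by
    have := ((tendsto_log_natCast.const_div_atTop γ).const_sub 1).sqrt
    simpa using this
  have hq : Tendsto (fun n : ℕ => γ * (log (log n) + log (4 * π)) / (2 * log (n : ℝ))) atTop
      (nhds 0) := by
    have h1 : Tendsto (fun L : ℝ => log L / L) atTop (nhds 0) := by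
      have := (isLittleO_log_rpow_atTop (r := 1) (by norm_num)).tendsto_div_nhds_zero
      simpa using this
    have h2 := (h1.comp tendsto_log_natCast).add
      (tendsto_log_natCast.const_div_atTop (log (4 * π)))
    have h3 := h2.const_mul (γ / 2)
    rw [add_zero, mul_zero] at h3
    refine h3.congr fun n => ?_
    simp only [Function.comp_apply]
    ring
  have hlim : Tendsto x' atTop (nhds (x + γ - √(2 * γ) * z)) := by
    have h1 := ((((hq.const_sub (2 * γ)).div (hρ.const_add 1) (by norm_num)).const_add x).sub_const
      (√(2 * γ) * z)).div hρ one_ne_zero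
    have e : (x + (2 * γ - 0) / (1 + 1) - √(2 * γ) * z) / 1 = x + γ - √(2 * γ) * z := by ring
    rwa [e] at h1
  have heq : ∀ᶠ n : ℕ in atTop, shiftedLevel γ n x z = un n (x' n) := by
    filter_upwards [tendsto_log_natCast.eventually_gt_atTop 0,
      tendsto_log_natCast.eventually_gt_atTop γ] with n hL0 hLγ
    rw [shiftedLevel, un_eq, un_eq]
    simp only [hx']
    set L := log (n : ℝ)
    set a := √(2 * L) with ha
    have ha0 : 0 < a := Real.sqrt_pos.2 (by linarith)
    have ha2 : a ^ 2 = 2 * L := Real.sq_sqrt (by linarith)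
    have hρ1 : γ / L < 1 := (div_lt_one hL0).2 hLγ
    set w := √(1 - γ / L) with hw
    have hw0 : 0 < w := Real.sqrt_pos.2 (by linarith)
    have hw2 : w ^ 2 = 1 - γ / L := Real.sq_sqrt (by linarith)
    have hs : √(2 * γ) = a * √(γ / L) := by
      rw [ha, ← Real.sqrt_mul (by linarith)]
      congr 1
      field_simp
    set κ := (log L + log (4 * π)) / 2 with hκ
    have e1 : γ * (log L + log (4 * π)) / (2 * L) = κ * (1 - w ^ 2) := by
      rw [hw2, hκ]
      field_simp
      ring
    have e2 : 2 * γ = a ^ 2 * (1 - w ^ 2) := by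
      rw [hw2, ha2]
      field_simp
      ring
    have e3 : (2 * γ - γ * (log L + log (4 * π)) / (2 * L)) / (1 + w)
        = (a ^ 2 - κ) * (1 - w) := by
      rw [e1, div_eq_iff (by positivity), e2]
      ring
    rw [e3, hs]
    field_simp
    ring
  have htail := (tendsto_natCast_mul_gaussianReal_real_Ioi_un hlim).neg
  have hg : rexp (-(x + γ - √(2 * γ) * z)) = g γ x z := by
    unfold g
    congr 1
    ring
  rw [hg] at htail
  have h1 : Tendsto (fun n : ℕ => (n : ℝ) * -(gaussianReal 0 1).real
      (Set.Ioi (shiftedLevel γ n x z))) atTop (nhds (-g γ x z)) := by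
    refine htail.congr' ?_
    filter_upwards [heq] with n hn
    rw [hn]
    ring
  refine (Real.tendsto_nat_mul_log_one_add_of_tendsto h1).congr fun n => ?_
  have h2 := probReal_compl_eq_one_sub (μ := gaussianReal 0 1)
    (measurableSet_Ioi (a := shiftedLevel γ n x z))
  rw [Set.compl_Ioi] at h2
  rw [h2, sub_eq_add_neg]

lemma MeasureTheory.TendstoInMeasure.pi {α ι κ : Type*} [Fintype κ] [MeasurableSpace α]
    {μ : Measure α} {f : ι → α → κ → ℝ} {h : α → κ → ℝ} {l : Filter ι}
    (hf : ∀ i, TendstoInMeasure μ (fun n a => f n a i) l fun a => h a i) :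
    TendstoInMeasure μ f l h := by
  intro η hη
  have h1 : Tendsto (fun n => ∑ i, μ {a | η ≤ edist (f n a i) (h a i)}) l (nhds 0) := by
    simpa using tendsto_finsetSum Finset.univ fun i _ => hf i η hη
  refine tendsto_of_tendsto_of_tendsto_of_le_of_le tendsto_const_nhds h1
    (fun _ => zero_le) fun n => ?_
  refine (measure_mono fun a ha => ?_).trans (measure_iUnion_fintype_le μ _)
  by_contra hcon
  simp only [Set.mem_iUnion, Set.mem_ofPred_eq, not_exists, not_le] at hcon
  refine (lt_irrefl η) (lt_of_le_of_lt (show η ≤ edist (f n a) (h a) from ha) ?_)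
  rw [edist_pi_def]
  exact (Finset.sup_lt_iff (bot_lt_iff_ne_bot.2 hη.ne')).2 fun i _ => hcon i

lemma ProbabilityTheory.IndepFun.measureReal_setOf_prodMk_mem {Ω α β : Type*}
    [MeasurableSpace Ω] [MeasurableSpace α] [MeasurableSpace β] {P : Measure Ω}
    [IsProbabilityMeasure P] {U : Ω → α} {V : Ω → β} (h : U ⟂ᵢ[P] V) (hU : Measurable U)
    (hV : Measurable V) {S : Set (α × β)} (hS : MeasurableSet S) :
    P.real {ω | (U ω, V ω) ∈ S} = ∫ ω, P.real {ω' | (U ω', V ω) ∈ S} ∂P := by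
  have := Measure.isProbabilityMeasure_map (μ := P) hU.aemeasurable
  have := Measure.isProbabilityMeasure_map (μ := P) hV.aemeasurable
  have h1 := (indepFun_iff_map_prod_eq_prod_map_map hU.aemeasurable hV.aemeasurable).1 h
  have h2 := congrArg (fun μ => μ S) h1
  rw [Measure.map_apply (hU.prodMk hV) hS, Measure.prod_apply_symm hS,
    lintegral_map (measurable_measure_prodMk_right hS) hV] at h2
  have h3 : ∀ ω, P.map U ((fun u => (u, V ω)) ⁻¹' S) = P {ω' | (U ω', V ω) ∈ S} := fun ω =>
    Measure.map_apply hU (measurable_prodMk_right hS)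
  simp only [h3] at h2
  have hmeas : Measurable fun ω => P {ω' | (U ω', V ω) ∈ S} := by
    simp only [← h3]
    exact (measurable_measure_prodMk_right hS).comp hV
  simp only [measureReal_def]
  rw [integral_toReal hmeas.aemeasurable (Eventually.of_forall fun ω => measure_lt_top _ _), ← h2]
  rfl

lemma tendsto_floor_natCast_mul_div {c : ℝ} (hc : 0 ≤ c) :
    Tendsto (fun n : ℕ => (⌊(n : ℝ) * c⌋₊ : ℝ) / n) atTop (nhds c) := by
  have := (tendsto_nat_floor_mul_div_atTop hc).comp (tendsto_natCast_atTop_atTop (R := ℝ))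
  simpa [Function.comp_def, mul_comm] using this

lemma tendsto_floor_natCast_mul {c : ℝ} (hc : 0 < c) :
    Tendsto (fun n : ℕ => ⌊(n : ℝ) * c⌋₊) atTop atTop := by
  have := tendsto_nat_floor_mul_atTop c hc
  simpa [Function.comp_def, mul_comm] using this

lemma sum_Icc_floor_eq_sub {c d : ℝ} (hcd : c ≤ d) (n : ℕ) (f : ℕ → ℝ) :
    ∑ j ∈ Finset.Icc (⌊(n : ℝ) * c⌋₊ + 1) ⌊(n : ℝ) * d⌋₊, f j
      = ∑ j ∈ Finset.Icc 1 ⌊(n : ℝ) * d⌋₊, f j - ∑ j ∈ Finset.Icc 1 ⌊(n : ℝ) * c⌋₊, f j := by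
  have h : ⌊(n : ℝ) * c⌋₊ ≤ ⌊(n : ℝ) * d⌋₊ := Nat.floor_mono (by gcongr)
  have hI : ∀ a b : ℕ, Finset.Icc (a + 1) b = Finset.Ioc a b := by
    intro a b
    ext
    simp
  have h1 := Finset.sum_Ioc_consecutive f (Nat.zero_le _) h
  have h2 := hI 0
  rw [zero_add] at h2
  rw [hI, h2, h2, ← h1]
  ring

/-- The conditional joint distribution function of a mixed equicorrelated sequence. -/
noncomputable def mixedProduct {k : ℕ} (γ : ℝ) (c d x y : Fin k → ℝ) (n : ℕ) (e : ℕ → Bool)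
    (z : ℝ) : ℝ :=
  ∏ i, ∏ j ∈ Finset.Icc (⌊(n : ℝ) * c i⌋₊ + 1) ⌊(n : ℝ) * d i⌋₊,
    (gaussianReal 0 1).real (Set.Iic (shiftedLevel γ n (if e j then x i else y i) z))

lemma mixedProduct_nonneg {k : ℕ} (γ : ℝ) (c d x y : Fin k → ℝ) (n : ℕ) (e : ℕ → Bool) (z : ℝ) :
    0 ≤ mixedProduct γ c d x y n e z :=
  Finset.prod_nonneg fun _ _ => Finset.prod_nonneg fun _ _ => measureReal_nonneg

lemma mixedProduct_le_one {k : ℕ} (γ : ℝ) (c d x y : Fin k → ℝ) (n : ℕ) (e : ℕ → Bool) (z : ℝ) :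
    mixedProduct γ c d x y n e z ≤ 1 :=
  Finset.prod_le_one (fun _ _ => Finset.prod_nonneg fun _ _ => measureReal_nonneg) fun _ _ =>
    Finset.prod_le_one (fun _ _ => measureReal_nonneg) fun _ _ => measureReal_le_one

lemma measurable_mixedProduct {k : ℕ} (γ : ℝ) (c d x y : Fin k → ℝ) (n : ℕ) :
    Measurable fun p : (ℕ → Bool) × ℝ => mixedProduct γ c d x y n p.1 p.2 := by
  have hΦ : Measurable fun v => (gaussianReal 0 1).real (Set.Iic v) :=
    Monotone.measurable fun a b hab => measureReal_mono (Set.Iic_subset_Iic.2 hab)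
  have hlev : ∀ x, Measurable fun z => shiftedLevel γ n x z := fun x => by
    unfold shiftedLevel
    fun_prop
  refine Finset.measurable_prod _ fun i _ => Finset.measurable_prod _ fun j _ => hΦ.comp ?_
  have he : MeasurableSet {p : (ℕ → Bool) × ℝ | p.1 j = true} :=
    measurableSet_eq_fun ((measurable_pi_apply j).comp measurable_fst) measurable_const
  have h : (fun p : (ℕ → Bool) × ℝ => shiftedLevel γ n (if p.1 j then x i else y i) p.2)
      = fun p => if p.1 j = true then shiftedLevel γ n (x i) p.2
        else shiftedLevel γ n (y i) p.2 := by
    ext p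
    split_ifs <;> rfl
  rw [h]
  exact Measurable.ite he ((hlev _).comp measurable_snd) ((hlev _).comp measurable_snd)

lemma gaussianReal_real_Iic_pos (v : ℝ) : 0 < (gaussianReal 0 1).real (Set.Iic v) := by
  rw [measureReal_def, gaussianReal_apply_eq_integral 0 one_ne_zero, ENNReal.toReal_ofReal
    (setIntegral_nonneg measurableSet_Iic fun t _ => gaussianPDFReal_nonneg 0 1 t),
    setIntegral_pos_iff_support_of_nonneg_ae
      (Eventually.of_forall fun t => gaussianPDFReal_nonneg 0 1 t)
      (integrable_gaussianPDFReal 0 1).integrableOn]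
  rw [Function.support_eq_univ fun t => (gaussianPDFReal_pos 0 1 t one_ne_zero).ne', Set.univ_inter,
    Real.volume_Iic]
  exact ENNReal.zero_lt_top

lemma mixedProduct_eq_exp {k : ℕ} (γ : ℝ) {c d : Fin k → ℝ} (x y : Fin k → ℝ)
    (hcd : ∀ i, c i ≤ d i) {n : ℕ} (hn : 0 < n) (e : ℕ → Bool) (z : ℝ) :
    mixedProduct γ c d x y n e z = rexp (∑ i,
      (((∑ j ∈ Finset.Icc 1 ⌊(n : ℝ) * d i⌋₊, (if e j then (1 : ℝ) else 0)) / n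
        - (∑ j ∈ Finset.Icc 1 ⌊(n : ℝ) * c i⌋₊, (if e j then (1 : ℝ) else 0)) / n)
        * (n * log ((gaussianReal 0 1).real (Set.Iic (shiftedLevel γ n (x i) z)))
          - n * log ((gaussianReal 0 1).real (Set.Iic (shiftedLevel γ n (y i) z))))
      + ((⌊(n : ℝ) * d i⌋₊ : ℝ) / n - (⌊(n : ℝ) * c i⌋₊ : ℝ) / n)
        * (n * log ((gaussianReal 0 1).real (Set.Iic (shiftedLevel γ n (y i) z)))))) := by
  have hn0 : (n : ℝ) ≠ 0 := by exact_mod_cast hn.ne'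
  rw [Real.exp_sum]
  refine Finset.prod_congr rfl fun i _ => ?_
  set lx := log ((gaussianReal 0 1).real (Set.Iic (shiftedLevel γ n (x i) z))) with hlx
  set ly := log ((gaussianReal 0 1).real (Set.Iic (shiftedLevel γ n (y i) z))) with hly
  have h1 : ∀ j, (gaussianReal 0 1).real (Set.Iic (shiftedLevel γ n (if e j then x i else y i) z))
      = rexp ((if e j then (1 : ℝ) else 0) * (lx - ly) + ly) := by
    intro j
    split_ifs
    · rw [one_mul, sub_add_cancel, hlx, Real.exp_log (gaussianReal_real_Iic_pos _)]
    · rw [zero_mul, zero_add, hly, Real.exp_log (gaussianReal_real_Iic_pos _)]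
  simp only [h1]
  rw [← Real.exp_sum, Finset.sum_add_distrib, ← Finset.sum_mul, sum_Icc_floor_eq_sub (hcd i),
    sum_Icc_floor_eq_sub (hcd i) n fun _ => ly]
  congr 1
  simp only [Finset.sum_const, Nat.card_Icc, Nat.add_sub_cancel, nsmul_eq_mul]
  field_simp

/-- Convergence of `mixedProduct` along a subsequence of proportions. -/
lemma tendsto_mixedProduct {k : ℕ} {γ : ℝ} {c d x y : Fin k → ℝ} (hc0 : ∀ i, 0 ≤ c i)
    (hcd : ∀ i, c i ≤ d i) {q : ℕ → ℕ} (hq : Tendsto q atTop atTop) {e : ℕ → Bool} {L : ℝ}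
    (hc : ∀ i, Tendsto (fun m => (∑ j ∈ Finset.Icc 1 ⌊(q m : ℝ) * c i⌋₊,
      (if e j then (1 : ℝ) else 0)) / ⌊(q m : ℝ) * c i⌋₊) atTop (nhds L))
    (hd : ∀ i, Tendsto (fun m => (∑ j ∈ Finset.Icc 1 ⌊(q m : ℝ) * d i⌋₊,
      (if e j then (1 : ℝ) else 0)) / ⌊(q m : ℝ) * d i⌋₊) atTop (nhds L)) (z : ℝ) :
    Tendsto (fun m => mixedProduct γ c d x y (q m) e z) atTop
      (nhds (∏ i, rexp (-(d i - c i) * (L * g γ (x i) z + (1 - L) * g γ (y i) z)))) := by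
  have hd0 : ∀ i, 0 ≤ d i := fun i => (hc0 i).trans (hcd i)
  have hprop : ∀ b : ℝ, 0 ≤ b → Tendsto (fun m => (∑ j ∈ Finset.Icc 1 ⌊(q m : ℝ) * b⌋₊,
      (if e j then (1 : ℝ) else 0)) / ⌊(q m : ℝ) * b⌋₊) atTop (nhds L) →
      Tendsto (fun m => (∑ j ∈ Finset.Icc 1 ⌊(q m : ℝ) * b⌋₊,
      (if e j then (1 : ℝ) else 0)) / q m) atTop (nhds (L * b)) := by
    intro b hb h
    refine (h.mul ((tendsto_floor_natCast_mul_div hb).comp hq)).congr fun m => ?_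
    simp only [Function.comp_apply]
    rcases Nat.eq_zero_or_pos ⌊(q m : ℝ) * b⌋₊ with h0 | h0
    · simp [h0]
    · have : (⌊(q m : ℝ) * b⌋₊ : ℝ) ≠ 0 := by exact_mod_cast h0.ne'
      field_simp
  have hlim : ∏ i, rexp (-(d i - c i) * (L * g γ (x i) z + (1 - L) * g γ (y i) z))
      = rexp (∑ i, ((L * d i - L * c i) * (-g γ (x i) z - -g γ (y i) z)
        + (d i - c i) * -g γ (y i) z)) := by
    rw [Real.exp_sum]
    refine Finset.prod_congr rfl fun i _ => ?_
    congr 1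
    ring
  rw [hlim]
  have hmain : Tendsto (fun m => rexp (∑ i,
      (((∑ j ∈ Finset.Icc 1 ⌊(q m : ℝ) * d i⌋₊, (if e j then (1 : ℝ) else 0)) / q m
        - (∑ j ∈ Finset.Icc 1 ⌊(q m : ℝ) * c i⌋₊, (if e j then (1 : ℝ) else 0)) / q m)
        * (q m * log ((gaussianReal 0 1).real (Set.Iic (shiftedLevel γ (q m) (x i) z)))
          - q m * log ((gaussianReal 0 1).real (Set.Iic (shiftedLevel γ (q m) (y i) z))))
      + ((⌊(q m : ℝ) * d i⌋₊ : ℝ) / q m - (⌊(q m : ℝ) * c i⌋₊ : ℝ) / q m)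
        * (q m * log ((gaussianReal 0 1).real (Set.Iic (shiftedLevel γ (q m) (y i) z)))))))
      atTop (nhds (rexp (∑ i, ((L * d i - L * c i) * (-g γ (x i) z - -g γ (y i) z)
        + (d i - c i) * -g γ (y i) z)))) := by
    refine (Real.continuous_exp.tendsto _).comp (tendsto_finsetSum _ fun i _ => ?_)
    exact (((hprop _ (hd0 i) (hd i)).sub (hprop _ (hc0 i) (hc i))).mul
      (((tendsto_natCast_mul_log_shiftedLevel γ (x i) z).comp hq).sub
        ((tendsto_natCast_mul_log_shiftedLevel γ (y i) z).comp hq))).add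
      ((((tendsto_floor_natCast_mul_div (hd0 i)).comp hq).sub
        ((tendsto_floor_natCast_mul_div (hc0 i)).comp hq)).mul
      ((tendsto_natCast_mul_log_shiftedLevel γ (y i) z).comp hq))
  refine hmain.congr' ?_
  filter_upwards [hq.eventually_gt_atTop 0] with m hm
  exact (mixedProduct_eq_exp γ x y hcd hm e z).symm

lemma un_mono (n : ℕ) {x x' : ℝ} (h : x ≤ x') : un n x ≤ un n x' := by
  unfold un
  gcongr

lemma integrable_mixedProduct {Ω : Type*} [MeasurableSpace Ω] {P : Measure Ω}
    [IsProbabilityMeasure P] {ε : ℕ → Ω → Bool} (hε : ∀ n, Measurable (ε n)) {k : ℕ} (γ : ℝ)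
    (c d x y : Fin k → ℝ) (n : ℕ) :
    Integrable (fun p : Ω × ℝ => mixedProduct γ c d x y n (fun j => ε j p.1) p.2)
      (P.prod (gaussianReal 0 1)) := by
  refine Integrable.of_bound (C := 1) (Measurable.aestronglyMeasurable ?_)
    (Eventually.of_forall fun p => ?_)
  · have h : Measurable fun p : Ω × ℝ => (fun j => ε j p.1, p.2) :=
      (measurable_pi_lambda _ fun j => (hε j).comp measurable_fst).prodMk measurable_snd
    have h' := (measurable_mixedProduct γ c d x y n).comp h
    simp only [Function.comp_def] at h'
    exact h'
  · rw [Real.norm_of_nonneg (mixedProduct_nonneg _ _ _ _ _ _ _ _)]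
    exact mixedProduct_le_one _ _ _ _ _ _ _ _

/-- Convergence of the integrals of `mixedProduct` under convergence in probability of the
proportions. -/
lemma tendsto_integral_mixedProduct {Ω : Type*} [MeasurableSpace Ω] {P : Measure Ω}
    [IsProbabilityMeasure P] {ε : ℕ → Ω → Bool} {lam : Ω → ℝ}
    (hε : ∀ n, Measurable (ε n)) (hlam : Measurable lam)
    (hlam01 : ∀ᵐ ω ∂P, lam ω ∈ Set.Icc (0 : ℝ) 1)
    (hS : TendstoInMeasure P
      (fun n ω => (∑ k ∈ Finset.Icc 1 n, (if ε k ω then (1 : ℝ) else 0)) / n) atTop lam)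
    {k : ℕ} {c d : Fin k → ℝ} (hc0 : ∀ i, 0 < c i) (hcd : ∀ i, c i < d i) (γ : ℝ)
    (x y : Fin k → ℝ) :
    Tendsto (fun n => ∫ p : Ω × ℝ, mixedProduct γ c d x y n (fun j => ε j p.1) p.2
        ∂(P.prod (gaussianReal 0 1))) atTop
      (nhds (∫ ω, ∫ z, ∏ i : Fin k,
        rexp (-(d i - c i) * (lam ω * g γ (x i) z + (1 - lam ω) * g γ (y i) z))
        ∂(gaussianReal 0 1) ∂P)) := by
  let G : Ω × ℝ → ℝ := fun p => ∏ i, rexp (-(d i - c i)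
    * (lam p.1 * g γ (x i) p.2 + (1 - lam p.1) * g γ (y i) p.2))
  have hGint : Integrable G (P.prod (gaussianReal 0 1)) := by
    have hgm : ∀ x, Measurable fun p : Ω × ℝ => g γ x p.2 := fun x => by
      unfold g
      fun_prop
    refine Integrable.of_bound (C := 1) ?_ ?_
    · refine (Finset.measurable_prod _ fun i _ => ?_).aestronglyMeasurable
      exact Real.measurable_exp.comp (measurable_const.mul
        (((hlam.comp measurable_fst).mul (hgm _)).add
          ((measurable_const.sub (hlam.comp measurable_fst)).mul (hgm _))))
    · filter_upwards [Measure.quasiMeasurePreserving_fst.ae hlam01] with p hp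
      rw [Real.norm_of_nonneg (Finset.prod_nonneg fun _ _ => (Real.exp_pos _).le)]
      refine Finset.prod_le_one (fun _ _ => (Real.exp_pos _).le) fun i _ => Real.exp_le_one_iff.2 ?_
      have h1 := hcd i
      have h2 : 0 ≤ lam p.1 * g γ (x i) p.2 + (1 - lam p.1) * g γ (y i) p.2 :=
        add_nonneg (mul_nonneg hp.1 (Real.exp_pos _).le)
          (mul_nonneg (by linarith [hp.2]) (Real.exp_pos _).le)
      exact mul_nonpos_of_nonpos_of_nonneg (by linarith) h2
  have hGe := integral_prod _ hGint
  simp only [G] at hGe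
  rw [← hGe]
  refine tendsto_of_subseq_tendsto fun ns hns => ?_
  have hpi : TendstoInMeasure P (fun n ω => fun b : Fin k ⊕ Fin k =>
      (∑ j ∈ Finset.Icc 1 ⌊(ns n : ℝ) * Sum.elim c d b⌋₊, (if ε j ω then (1 : ℝ) else 0))
        / ⌊(ns n : ℝ) * Sum.elim c d b⌋₊) atTop fun ω _ => lam ω := by
    refine TendstoInMeasure.pi fun b => ?_
    have hb : 0 < Sum.elim c d b := by
      rcases b with i | i
      · exact hc0 i
      · exact (hc0 i).trans (hcd i)
    exact hS.comp ((tendsto_floor_natCast_mul hb).comp hns)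
  obtain ⟨ms, hms, hae⟩ := hpi.exists_seq_tendsto_ae
  refine ⟨ms, tendsto_integral_of_dominated_convergence (fun _ => (1 : ℝ))
    (fun n => (integrable_mixedProduct hε γ c d x y _).aestronglyMeasurable) (integrable_const _)
    (fun n => Eventually.of_forall fun p => ?_) ?_⟩
  · rw [Real.norm_of_nonneg (mixedProduct_nonneg _ _ _ _ _ _ _ _)]
    exact mixedProduct_le_one _ _ _ _ _ _ _ _
  filter_upwards [Measure.quasiMeasurePreserving_fst.ae hae] with p hp
  have hp' := tendsto_pi_nhds.1 hp
  exact tendsto_mixedProduct (fun i => (hc0 i).le) (fun i => (hcd i).le)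
    (hns.comp hms.tendsto_atTop) (fun i => hp' (Sum.inl i)) (fun i => hp' (Sum.inr i)) p.2

/-- Reduction of the comparison for the thinned sequence to the comparison for deterministic
index sets and levels, by conditioning on the indicators. -/
lemma abs_measureReal_sub_integral_mixedProduct_le {Ω : Type*} [MeasurableSpace Ω] {P : Measure Ω}
    [IsProbabilityMeasure P] {X : ℕ → Ω → ℝ} {ε : ℕ → Ω → Bool} {γ : ℝ}
    (hX : ∀ n, Measurable (X n)) (hε : ∀ n, Measurable (ε n))
    (hindep : IndepFun (fun ω => fun n => X n ω) (fun ω => fun n => ε n ω) P)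
    {k : ℕ} {c d : Fin k → ℝ} (hdc : ∀ i j : Fin k, i < j → d i ≤ c j) (hd1 : ∀ i, d i ≤ 1)
    {x y : Fin k → ℝ} {x₀ B : ℝ} (hx₀ : ∀ i, x₀ ≤ x i) (hy₀ : ∀ i, x₀ ≤ y i) {n : ℕ}
    (hB : ∀ {ι : Type} [Fintype ι] {idx : ι → ℕ}, Function.Injective idx →
      (∀ p, idx p ∈ Finset.Icc 1 n) → ∀ {l : ι → ℝ}, (∀ p, un n x₀ ≤ l p) →
      |∫ z, ∏ p, (gaussianReal 0 1).real (Set.Iic ((l p - √(γ / log n) * z) / √(1 - γ / log n)))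
          ∂(gaussianReal 0 1) - P.real {ω | ∀ p, X (idx p) ω ≤ l p}| ≤ B) :
    |P.real {ω | ∀ i : Fin k, ∀ j ∈ Finset.Icc (⌊(n : ℝ) * c i⌋₊ + 1) ⌊(n : ℝ) * d i⌋₊,
        (ε j ω = true → X j ω ≤ un n (x i)) ∧ (ε j ω = false → X j ω ≤ un n (y i))}
      - ∫ p : Ω × ℝ, mixedProduct γ c d x y n (fun j => ε j p.1) p.2
        ∂(P.prod (gaussianReal 0 1))| ≤ B := by
  have hXvec : Measurable fun ω => fun n => X n ω := measurable_pi_lambda _ hX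
  have hεvec : Measurable fun ω => fun n => ε n ω := measurable_pi_lambda _ hε
  have hFint := integrable_mixedProduct (P := P) hε γ c d x y n
  let ι : Type := Σ i : Fin k, ↥(Finset.Icc (⌊(n : ℝ) * c i⌋₊ + 1) ⌊(n : ℝ) * d i⌋₊)
  let idx : ι → ℕ := fun p => p.2.1
  let lev : (ℕ → Bool) → ι → ℝ := fun e p => un n (if e p.2.1 then x p.1 else y p.1)
  have hidx : ∀ p, idx p ∈ Finset.Icc 1 n := by
    rintro ⟨i, j, hj⟩
    obtain ⟨h1, h2⟩ := Finset.mem_Icc.1 hj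
    refine Finset.mem_Icc.2 ⟨(Nat.le_add_left _ _).trans h1, h2.trans ?_⟩
    refine Nat.floor_le_of_le ?_
    exact mul_le_of_le_one_right (Nat.cast_nonneg n) (hd1 i)
  have hinj : Function.Injective idx := by
    rintro ⟨i, j, hj⟩ ⟨i', j', hj'⟩ h
    obtain rfl : j = j' := h
    have hsep : ∀ i i' : Fin k, i < i' → ⌊(n : ℝ) * d i⌋₊ ≤ ⌊(n : ℝ) * c i'⌋₊ := fun i i' h =>
      Nat.floor_mono (mul_le_mul_of_nonneg_left (hdc i i' h) (Nat.cast_nonneg n))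
    obtain ⟨h1, h2⟩ := Finset.mem_Icc.1 hj
    obtain ⟨h3, h4⟩ := Finset.mem_Icc.1 hj'
    rcases lt_trichotomy i i' with hi | rfl | hi
    · have := hsep _ _ hi
      omega
    · rfl
    · have := hsep _ _ hi
      omega
  have hset : {ω | ∀ i : Fin k, ∀ j ∈ Finset.Icc (⌊(n : ℝ) * c i⌋₊ + 1) ⌊(n : ℝ) * d i⌋₊,
      (ε j ω = true → X j ω ≤ un n (x i)) ∧ (ε j ω = false → X j ω ≤ un n (y i))}
      = {ω | ((fun j => X j ω), (fun j => ε j ω)) ∈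
        {q : (ℕ → ℝ) × (ℕ → Bool) | ∀ p : ι, q.1 (idx p) ≤ lev q.2 p}} := by
    ext ω
    simp only [Set.mem_ofPred_eq]
    constructor
    · rintro h ⟨i, j, hj⟩
      have h1 := h i j hj
      simp only [idx, lev]
      split_ifs with he
      · exact h1.1 he
      · exact h1.2 (by simpa using he)
    · intro h i j hj
      have h1 := h ⟨i, j, hj⟩
      simp only [idx, lev] at h1
      constructor <;> intro he <;> simpa [he] using h1
  have hSm : MeasurableSet {q : (ℕ → ℝ) × (ℕ → Bool) | ∀ p : ι, q.1 (idx p) ≤ lev q.2 p} := by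
    rw [Set.ofPred_forall]
    refine MeasurableSet.iInter fun p => measurableSet_le
      ((measurable_pi_apply _).comp measurable_fst) ?_
    have h2 : Measurable fun b : Bool => un n (if b then x p.1 else y p.1) :=
      measurable_from_top
    exact h2.comp ((measurable_pi_apply p.2.1).comp measurable_snd)
  have hcond := hindep.measureReal_setOf_prodMk_mem hXvec hεvec hSm
  rw [← hset] at hcond
  have hinner : ∀ ω, ∫ z, mixedProduct γ c d x y n (fun j => ε j ω) z ∂(gaussianReal 0 1)
      = ∫ z, ∏ p : ι, (gaussianReal 0 1).real (Set.Iic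
      ((lev (fun j => ε j ω) p - √(γ / log n) * z) / √(1 - γ / log n))) ∂(gaussianReal 0 1) := by
    intro ω
    refine integral_congr_ae (Eventually.of_forall fun z => ?_)
    simp only [mixedProduct, ι, Fintype.prod_sigma, shiftedLevel, lev]
    refine Finset.prod_congr rfl fun i _ => ?_
    exact (Finset.prod_coe_sort _ fun j => (gaussianReal 0 1).real (Set.Iic
      ((un n (if ε j ω then x i else y i) - √(γ / log n) * z) / √(1 - γ / log n)))).symm
  have hbound : ∀ ω, ‖∫ z, mixedProduct γ c d x y n (fun j => ε j ω) z ∂(gaussianReal 0 1)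
      - P.real {ω' | ((fun j => X j ω'), (fun j => ε j ω)) ∈
        {q : (ℕ → ℝ) × (ℕ → Bool) | ∀ p : ι, q.1 (idx p) ≤ lev q.2 p}}‖ ≤ B := by
    intro ω
    rw [hinner ω]
    refine hB hinj hidx (l := lev fun j => ε j ω) fun p => un_mono n ?_
    split_ifs
    · exact hx₀ _
    · exact hy₀ _
  have hint2 : Integrable (fun ω => P.real {ω' | ((fun j => X j ω'), (fun j => ε j ω)) ∈
      {q : (ℕ → ℝ) × (ℕ → Bool) | ∀ p : ι, q.1 (idx p) ≤ lev q.2 p}}) P := by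
    refine Integrable.of_bound (C := 1) ?_ (Eventually.of_forall fun ω => ?_)
    · have h1 := (measurable_measure_prodMk_right
        (μ := P.map fun ω => fun j => X j ω) hSm).comp hεvec
      refine h1.ennreal_toReal.aestronglyMeasurable.congr (Eventually.of_forall fun ω => ?_)
      exact congrArg ENNReal.toReal (Measure.map_apply hXvec (measurable_prodMk_right hSm))
    · rw [Real.norm_of_nonneg measureReal_nonneg]
      exact measureReal_le_one
  rw [hcond, integral_prod _ hFint, abs_sub_comm,
    ← integral_sub hFint.integral_prod_left hint2]
  refine (norm_integral_le_of_norm_le_const (μ := P) (Eventually.of_forall hbound)).trans ?_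
  simp

theorem stmt14
    {Ω : Type} [MeasurableSpace Ω] (P : Measure Ω) [IsProbabilityMeasure P]
    (X : ℕ → Ω → ℝ) (ε : ℕ → Ω → Bool) (lam : Ω → ℝ) (γ : ℝ)
    (hγ : 0 ≤ γ)
    (hXmeas : ∀ n, Measurable (X n))
    (hεmeas : ∀ n, Measurable (ε n))
    (hlam : Measurable lam)
    -- every finite-dimensional distribution of `X` is centered Gaussian
    (hGauss : ∀ (m : ℕ) (idx : Fin m → ℕ) (c : Fin m → ℝ), ∃ v : ℝ≥0,
      Measure.map (fun ω => ∑ i, c i * X (idx i) ω) P = gaussianReal 0 v)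
    -- each `X n` is standard Gaussian
    (hstd : ∀ n, Measure.map (X n) P = gaussianReal 0 1)
    -- stationarity
    (hstat : ∀ (m k : ℕ),
      Measure.map (fun ω => fun i : Fin m => X (i.1 + 1 + k) ω) P =
        Measure.map (fun ω => fun i : Fin m => X (i.1 + 1) ω) P)
    -- `r_n ln n → γ`
    (hr : Tendsto (fun n : ℕ => (∫ ω, X 1 ω * X (n + 1) ω ∂P) * Real.log n)
      atTop (nhds γ))
    -- independence of the sequences `X` and `ε`
    (hindep : IndepFun (fun ω => fun n => X n ω) (fun ω => fun n => ε n ω) P)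
    (hlam01 : ∀ᵐ ω ∂P, lam ω ∈ Set.Icc (0 : ℝ) 1)
    -- `S_n / n → λ` in probability
    (hS : TendstoInMeasure P
      (fun n ω => (∑ k ∈ Finset.Icc 1 n, (if ε k ω then (1 : ℝ) else 0)) / n)
      atTop lam)
    (k : ℕ) (hk : 1 ≤ k) (c d : Fin k → ℝ)
    (hc0 : ∀ i, 0 < c i) (hcd : ∀ i, c i < d i)
    (hdc : ∀ i j : Fin k, i < j → d i ≤ c j) (hd1 : ∀ i, d i ≤ 1)
    (x y : Fin k → ℝ) :
    Tendsto (fun n : ℕ =>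
      (P {ω | ∀ i : Fin k, ∀ j ∈ Finset.Icc (⌊(n : ℝ) * c i⌋₊ + 1) ⌊(n : ℝ) * d i⌋₊,
          (ε j ω = true → X j ω ≤ un n (x i)) ∧
          (ε j ω = false → X j ω ≤ un n (y i))}).toReal)
      atTop
      (nhds (∫ ω, ∫ z, ∏ i : Fin k,
        Real.exp (-(d i - c i) * (lam ω * g γ (x i) z + (1 - lam ω) * g γ (y i) z))
        ∂(gaussianReal 0 1) ∂P)) := by
  set r : ℕ → ℝ := fun n => ∫ ω, X 1 ω * X (n + 1) ω ∂P
  have hr0 : Tendsto r atTop (nhds 0) := by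
    refine (hr.div_atTop tendsto_log_natCast).congr' ?_
    filter_upwards [tendsto_log_natCast.eventually_gt_atTop 0] with n hn
    field_simp
    rfl
  obtain ⟨δ, hδ2, hδ, hrδ⟩ := exists_abs_integral_mul_le hXmeas hstd hstat hr0
  obtain ⟨C, -, hC⟩ := exists_equicorrelated_comparison hXmeas hGauss hstd hstat
    (r := r) (fun n => rfl) hδ2 hδ hrδ
  obtain ⟨x₀, hx₀, hy₀⟩ : ∃ x₀, (∀ i, x₀ ≤ x i) ∧ ∀ i, x₀ ≤ y i := by
    obtain ⟨a, ha⟩ := (Set.finite_range x).bddBelow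
    obtain ⟨b, hb⟩ := (Set.finite_range y).bddBelow
    exact ⟨min a b, fun i => (min_le_left _ _).trans (ha ⟨i, rfl⟩),
      fun i => (min_le_right _ _).trans (hb ⟨i, rfl⟩)⟩
  set err : ℕ → ℝ := fun n => n * ∑ k ∈ Finset.Icc 1 n, |γ / log n - r k|
    * rexp (-(un n x₀) ^ 2 / (1 + max |r k| |γ / log n|))
  have herr0 : Tendsto err atTop (nhds 0) := tendsto_comparison_sum hγ hδ hδ2 hrδ hr x₀
  have hcomp : ∀ᶠ n : ℕ in atTop, ‖(P {ω | ∀ i : Fin k,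
      ∀ j ∈ Finset.Icc (⌊(n : ℝ) * c i⌋₊ + 1) ⌊(n : ℝ) * d i⌋₊,
        (ε j ω = true → X j ω ≤ un n (x i)) ∧ (ε j ω = false → X j ω ≤ un n (y i))}).toReal
      - ∫ p : Ω × ℝ, mixedProduct γ c d x y n (fun j => ε j p.1) p.2
        ∂(P.prod (gaussianReal 0 1))‖ ≤ C * err n := by
    filter_upwards [eventually_un_bounds x₀, tendsto_log_natCast.eventually_gt_atTop 0,
      tendsto_log_natCast.eventually_ge_atTop (2 * γ)] with n hun hL0 hLγ
    have hρ : γ / log (n : ℝ) ≤ 1 / 2 := by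
      rw [div_le_iff₀ hL0]
      linarith
    exact abs_measureReal_sub_integral_mixedProduct_le hXmeas hεmeas hindep hdc hd1 hx₀ hy₀
      fun hinj hidx _ hl => hC hinj hidx (div_nonneg hγ hL0.le) hρ hun.1 hl
  have hdiff := squeeze_zero_norm' hcomp (by simpa using herr0.const_mul C)
  have hsum := hdiff.add (tendsto_integral_mixedProduct hεmeas hlam hlam01 hS hc0 hcd γ x y)
  simpa only [sub_add_cancel, zero_add] using hsum
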